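/- arXiv:1404.1516 — 2 statements merged into one kernel-verified Lean document; each statement's English description precedes it below -/
import Mathlib

section
/- Let G : D([0,T];ℝ^d) → ℝ be bounded, Borel measurable, and uniformly continuous for the Skorokhod distance, i.e. there is a function m_G : [0,∞) → [0,∞), continuous at 0 with m_G(0) = 0, such that |G(ω) − G(ω̃)| ≤ m_G(d(ω,ω̃)) for all ω, ω̃. For a Borel probability measure ν on ℝ^d, let M̃_ν be the set of martingale measures Q on Ω = D([0,T];ℝ^d) under which the law of S_T equals ν, and set v(ν) := sup_{Q ∈ M̃_ν} E_Q[G(S)] (with sup over the empty set := −∞). Let (ν_n)_{n≥1} be Borel probability measures on ℝ^d, each with finite first moments and barycenter ∫ x dν_n(x) = (1,…,1), converging weakly to a probability measure μ that is supported on (0,∞)^d and has barycenter ∫ x dμ(x) = (1,…,1), and assume that for each coordinate k = 1,…,d one has ∫ max(−x_k, 0) dν_n(x) → 0 as n → ∞. Then lim_{n→∞} v(ν_n) = v(μ). -/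
open MeasureTheory Filter Set

noncomputable section

/-- `ℝ^d` with the Euclidean norm. -/
abbrev E (d : ℕ) : Type := EuclideanSpace ℝ (Fin d)

/-- `f` is càdlàg on `[0,T]`: right-continuous on `[0,T)` and with left limits on `(0,T]`. -/
def IsCadlagOn (d : ℕ) (T : ℝ) (f : ℝ → E d) : Prop :=
  (∀ t ∈ Set.Ico (0:ℝ) T, Tendsto f (nhdsWithin t (Set.Ioo t T)) (nhds (f t))) ∧
  (∀ t ∈ Set.Ioc (0:ℝ) T, ∃ L, Tendsto f (nhdsWithin t (Set.Ico 0 t)) (nhds L))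

/-- `f` is (left-)continuous at maturity `t = T`. -/
def ContinuousAtMaturity (d : ℕ) (T : ℝ) (f : ℝ → E d) : Prop :=
  Tendsto f (nhdsWithin T (Set.Ico 0 T)) (nhds (f T))

/-- The path space `D([0,T];ℝ^d)`: càdlàg paths, starting at `(1,…,1)`, continuous at `T`. -/
def DReal (d : ℕ) (T : ℝ) : Set (ℝ → E d) :=
  {f | IsCadlagOn d T f ∧ ContinuousAtMaturity d T f ∧ ∀ i, f 0 i = 1}

/-- The Skorokhod distance on paths, as the infimum over strictly increasing bijections
`λ` of `[0,T]` onto itself of `sup_t (|ω(t) − ω̃(λ(t))| + |λ(t) − t|)`. -/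
def skorokhodDist (d : ℕ) (T : ℝ) (ω ωt : ℝ → E d) : ℝ :=
  sInf {r : ℝ | ∃ lam : ℝ → ℝ, StrictMonoOn lam (Set.Icc 0 T) ∧
    Set.BijOn lam (Set.Icc 0 T) (Set.Icc 0 T) ∧
    ∀ t ∈ Set.Icc (0:ℝ) T, ‖ω t - ωt (lam t)‖ + |lam t - t| ≤ r}

/-- The σ-algebra on the path space generated by the coordinate maps `ω ↦ ω(t)`, `t ∈ [0,T]`. -/
instance pathSigma (d : ℕ) (T : ℝ) : MeasurableSpace ↥(DReal d T) :=
  ⨆ t : Set.Icc (0:ℝ) T,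
    MeasurableSpace.comap (fun ω : ↥(DReal d T) => (ω : ℝ → E d) t.1) inferInstance

/-- The canonical filtration `F_s = σ(S_u : 0 ≤ u ≤ s)`. -/
def canFilt (d : ℕ) (T s : ℝ) : MeasurableSpace ↥(DReal d T) :=
  ⨆ u : {u : ℝ // 0 ≤ u ∧ u ≤ s},
    MeasurableSpace.comap (fun ω : ↥(DReal d T) => (ω : ℝ → E d) u.1) inferInstance

/-- `Q` is a martingale measure: a probability measure on the path space under which each
coordinate process `S_t`, `t ∈ [0,T]`, is integrable and a martingale for the canonical
filtration. -/
def IsMartingaleMeasure (d : ℕ) (T : ℝ) (Q : Measure ↥(DReal d T)) : Prop :=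
  IsProbabilityMeasure Q ∧
  (∀ t ∈ Set.Icc (0:ℝ) T, Integrable (fun ω : ↥(DReal d T) => (ω : ℝ → E d) t) Q) ∧
  ∀ s t : ℝ, 0 ≤ s → s ≤ t → t ≤ T → ∀ i : Fin d,
    (fun ω : ↥(DReal d T) => (ω : ℝ → E d) s i)
      =ᵐ[Q] Q[(fun ω : ↥(DReal d T) => (ω : ℝ → E d) t i)|canFilt d T s]

/-- `v(ν) = sup_{Q ∈ M̃_ν} E_Q[G]`, with the supremum (in `EReal`) over all martingale
measures under which the law of `S_T` is `ν`; `sup ∅ = ⊥ = −∞`. -/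
def vfun (d : ℕ) (T : ℝ) (G : ↥(DReal d T) → ℝ) (ν : Measure (E d)) : EReal :=
  sSup {x : EReal | ∃ Q : Measure ↥(DReal d T), IsMartingaleMeasure d T Q ∧
    Measure.map (fun ω : ↥(DReal d T) => (ω : ℝ → E d) T) Q = ν ∧
    x = ((∫ ω, G ω ∂Q : ℝ) : EReal)}


open scoped ENNReal ProbabilityTheory

def stepPath {d : ℕ} (h : ℝ) (n : ℕ) (x : ℕ → E d) : ℝ → E d := fun t => x (min ⌊t / h⌋₊ n)

lemma floor_right {h t : ℝ} (hh : 0 < h) (ht : 0 ≤ t) :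
    ∀ᶠ s in nhdsWithin t (Ioi t), ⌊s / h⌋₊ = ⌊t / h⌋₊ := by
  have h1 : t < h * (⌊t / h⌋₊ + 1) := by
    have := Nat.lt_floor_add_one (t / h)
    rwa [div_lt_iff₀ hh, mul_comm] at this
  filter_upwards [Ioo_mem_nhdsGT h1] with s hs
  have hs0 : 0 ≤ s := ht.trans hs.1.le
  rw [Nat.floor_eq_iff (by positivity)]
  refine ⟨(Nat.floor_le (by positivity)).trans (by gcongr; exact hs.1.le), ?_⟩
  rw [div_lt_iff₀ hh, mul_comm]; exact hs.2

lemma floor_left {h t : ℝ} (hh : 0 < h) (ht : 0 < t) :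
    ∀ᶠ s in nhdsWithin t (Ico 0 t), ⌊s / h⌋₊ = ⌈t / h⌉₊ - 1 := by
  have hpos : 0 < ⌈t / h⌉₊ := Nat.ceil_pos.2 (by positivity)
  obtain ⟨k, hk⟩ : ∃ k, ⌈t / h⌉₊ = k + 1 := ⟨⌈t / h⌉₊ - 1, by omega⟩
  have h1 : h * k < t := by
    have : k < ⌈t / h⌉₊ := by omega
    rw [Nat.lt_ceil, lt_div_iff₀ hh, mul_comm] at this; exact this
  have h2 : t ≤ h * (k + 1) := by
    have := Nat.le_ceil (t / h)
    rw [hk, div_le_iff₀ hh, mul_comm] at this; exact_mod_cast this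
  have : Ioi (h * k) ∈ nhdsWithin t (Ico 0 t) := mem_nhdsWithin_of_mem_nhds (Ioi_mem_nhds h1)
  filter_upwards [this, self_mem_nhdsWithin] with s hs hs'
  rw [hk, Nat.add_sub_cancel, Nat.floor_eq_iff (div_nonneg hs'.1 hh.le), le_div_iff₀ hh,
    div_lt_iff₀ hh, mul_comm, mul_comm _ h]
  exact ⟨hs.le, hs'.2.trans_le h2⟩

lemma stepPath_T {d : ℕ} {T : ℝ} (hT : 0 < T) (n : ℕ) (x : ℕ → E d) {t : ℝ}
    (ht : T / (n + 1) * n ≤ t) : stepPath (T / (n + 1)) n x t = x n := by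
  unfold stepPath
  congr 1
  apply min_eq_right
  apply Nat.le_floor
  rw [le_div_iff₀ (by positivity), mul_comm]; exact ht

lemma hn_lt {T : ℝ} (hT : 0 < T) (n : ℕ) : T / (n + 1) * n < T := by
  rw [div_mul_eq_mul_div, div_lt_iff₀ (by positivity)]; nlinarith

lemma stepPath_mem {d : ℕ} {T : ℝ} (hT : 0 < T) (n : ℕ) (x : ℕ → E d) (hx : ∀ i, x 0 i = 1) :
    stepPath (T / (n + 1)) n x ∈ DReal d T := by
  have hh : 0 < T / ((n : ℝ) + 1) := by positivity
  refine ⟨⟨?_, ?_⟩, ?_, ?_⟩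
  · intro t ht
    apply tendsto_nhds_of_eventually_eq
    have := (floor_right hh ht.1).filter_mono (nhdsWithin_mono t (fun y (hy : y ∈ Ioo t T) => hy.1))
    filter_upwards [this] with s hs
    simp only [stepPath, hs]
  · intro t ht
    refine ⟨x (min (⌈t / (T / ((n : ℝ) + 1))⌉₊ - 1) n), ?_⟩
    apply tendsto_nhds_of_eventually_eq
    filter_upwards [floor_left hh ht.1] with s hs
    simp only [stepPath, hs]
  · apply tendsto_nhds_of_eventually_eq
    have : Ioi (T / ((n : ℝ) + 1) * n) ∈ nhdsWithin T (Ico 0 T) :=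
      mem_nhdsWithin_of_mem_nhds (Ioi_mem_nhds (hn_lt hT n))
    filter_upwards [this] with s hs
    rw [stepPath_T hT n x (le_of_lt hs), stepPath_T hT n x (hn_lt hT n).le]
  · intro i
    simp [stepPath, hx]

lemma skor_nonneg {d : ℕ} {T : ℝ} (hT : 0 < T) (a b : ℝ → E d) : 0 ≤ skorokhodDist d T a b := by
  apply Real.sInf_nonneg
  rintro r ⟨lam, -, -, h⟩
  have := h 0 ⟨le_rfl, hT.le⟩
  exact le_trans (by positivity) this

lemma skor_le {d : ℕ} {T : ℝ} (hT : 0 < T) {a b : ℝ → E d} {r : ℝ} (lam : ℝ → ℝ)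
    (h1 : StrictMonoOn lam (Icc 0 T)) (h2 : BijOn lam (Icc 0 T) (Icc 0 T))
    (h3 : ∀ t ∈ Icc (0:ℝ) T, ‖a t - b (lam t)‖ + |lam t - t| ≤ r) :
    skorokhodDist d T a b ≤ r := by
  apply csInf_le
  · refine ⟨0, ?_⟩
    rintro r ⟨lam, -, -, h⟩
    have := h 0 ⟨le_rfl, hT.le⟩
    exact le_trans (by positivity) this
  · exact ⟨lam, h1, h2, h3⟩

lemma skor_step_le {d : ℕ} {T : ℝ} (hT : 0 < T) (n : ℕ) (x y : ℕ → E d) {r : ℝ}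
    (h : ∀ j ≤ n, ‖x j - y j‖ ≤ r) :
    skorokhodDist d T (stepPath (T / (n + 1)) n x) (stepPath (T / (n + 1)) n y) ≤ r := by
  apply skor_le hT id (strictMono_id.strictMonoOn _) (bijOn_id _)
  intro t _
  simp only [id, sub_self, abs_zero, add_zero]
  exact h _ (min_le_right _ _)

def Pgood {d : ℕ} (T : ℝ) (f : ℝ → E d) (ε a : ℝ) : Prop :=
  ∀ᶠ n : ℕ in atTop, ∃ lam : ℝ → ℝ, StrictMonoOn lam (Icc 0 a) ∧ lam 0 = 0 ∧
    lam a = T / (n + 1) * ⌈a / (T / (n + 1))⌉₊ ∧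
    SurjOn lam (Icc 0 a) (Icc 0 (T / (n + 1) * ⌈a / (T / (n + 1))⌉₊)) ∧
    (∀ t ∈ Ico 0 a, ‖f t - f (T / (n + 1) * ⌊lam t / (T / (n + 1))⌋₊)‖ ≤ ε) ∧
    ∀ t ∈ Icc 0 a, |lam t - t| ≤ T / (n + 1)

lemma Pgood_zero {d : ℕ} (T : ℝ) (hT : 0 < T) (f : ℝ → E d) (ε : ℝ) : Pgood T f ε 0 := by
  refine Eventually.of_forall fun n => ⟨id, strictMono_id.strictMonoOn _, rfl, by simp, ?_, ?_, ?_⟩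
  · simp [SurjOn]
  · intro t ht; exact absurd ht.2 (not_lt.2 ht.1)
  · intro t ht; simp; positivity

lemma Pgood_step {d : ℕ} (T : ℝ) (hT : 0 < T) (f : ℝ → E d) (ε : ℝ) {b a : ℝ} (hb : 0 ≤ b)
    (hba : b < a) (hosc : ∀ s ∈ Ico b a, ∀ t ∈ Ico b a, ‖f s - f t‖ ≤ ε)
    (H : Pgood T f ε b) : Pgood T f ε a := by
  have hlim : Tendsto (fun n : ℕ => T / ((n : ℝ) + 1)) atTop (nhds 0) :=
    tendsto_const_div_atTop_nhds_zero_nat T |>.comp (tendsto_add_atTop_nat 1) |>.congr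
      (fun n => by simp)
  filter_upwards [H, hlim.eventually (gt_mem_nhds (sub_pos.2 hba))] with n ⟨lam, hm, h0, hlb, hs, hf, hl⟩ hn
  set h := T / ((n : ℝ) + 1) with hh_def
  have hh : 0 < h := by positivity
  obtain ⟨gb, hgb⟩ : ∃ gb, gb = h * (⌈b / h⌉₊ : ℝ) := ⟨_, rfl⟩
  obtain ⟨ga, hga⟩ : ∃ ga, ga = h * (⌈a / h⌉₊ : ℝ) := ⟨_, rfl⟩
  have ceil1 : ∀ s : ℝ, s ≤ h * (⌈s / h⌉₊ : ℝ) := fun s => by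
    have := Nat.le_ceil (s / h)
    rwa [div_le_iff₀ hh, mul_comm] at this
  have ceil2 : ∀ s : ℝ, 0 ≤ s → h * (⌈s / h⌉₊ : ℝ) < s + h := fun s hs => by
    have := Nat.ceil_lt_add_one (div_nonneg hs hh.le)
    have := mul_lt_mul_of_pos_left this hh
    rwa [mul_add, mul_div_cancel₀ _ hh.ne', mul_one] at this
  have b1 : b ≤ gb := hgb ▸ ceil1 b
  have b2 : gb < b + h := hgb ▸ ceil2 b hb
  have a1 : a ≤ ga := hga ▸ ceil1 a
  have a2 : ga < a + h := hga ▸ ceil2 a (hb.trans hba.le)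
  have hgg : gb < ga := by linarith
  rw [← hgb] at hlb hs
  rw [← hga]
  have hpt : ∀ u, gb ≤ u → u < ga → h * (⌊u / h⌋₊ : ℝ) ∈ Ico b a := by
    intro u hu1 hu2
    have hu0 : 0 ≤ u := hb.trans (b1.trans hu1)
    constructor
    · refine b1.trans ?_
      rw [hgb]
      gcongr
      apply Nat.le_floor
      rw [le_div_iff₀ hh, mul_comm, ← hgb]; exact hu1
    · have : ⌊u / h⌋₊ < ⌈a / h⌉₊ := by
        rw [Nat.floor_lt (by positivity), div_lt_iff₀ hh, mul_comm, ← hga]; exact hu2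
      rw [Nat.lt_ceil, lt_div_iff₀ hh, mul_comm] at this
      exact this
  have hab : 0 < a - b := sub_pos.2 hba
  have hc : 0 < (ga - gb) / (a - b) := div_pos (sub_pos.2 hgg) hab
  set c := (ga - gb) / (a - b) with hc_def
  have hca : c * (a - b) = ga - gb := div_mul_cancel₀ _ hab.ne'
  have e0 : ∀ t, t ≤ b → (if t ≤ b then lam t else gb + (t - b) * c) = lam t :=
    fun t ht => if_pos ht
  have e1 : ∀ t, b ≤ t → (if t ≤ b then lam t else gb + (t - b) * c) = gb + (t - b) * c := by
    intro t ht
    split_ifs with h'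
    · have : t = b := le_antisymm h' ht
      subst this; simp [hlb]
    · rfl
  refine ⟨fun t => if t ≤ b then lam t else gb + (t - b) * c, ?_, ?_, ?_, ?_, ?_, ?_⟩
  · intro s hs' t ht' hst
    simp only
    by_cases htb : t ≤ b
    · rw [e0 t htb, e0 s (hst.le.trans htb)]
      exact hm ⟨hs'.1, hst.le.trans htb⟩ ⟨ht'.1, htb⟩ hst
    · push Not at htb
      rw [e1 t htb.le]
      by_cases hsb : s ≤ b
      · rw [e0 s hsb]
        have : lam s ≤ lam b := hm.monotoneOn ⟨hs'.1, hsb⟩ ⟨hb, le_rfl⟩ hsb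
        have : 0 < (t - b) * c := mul_pos (sub_pos.2 htb) hc
        linarith
      · rw [e1 s (not_le.1 hsb).le]
        have := mul_lt_mul_of_pos_right (sub_lt_sub_right hst b) hc
        linarith
  · simp only; rw [e0 0 hb, h0]
  · simp only; rw [e1 a hba.le]; linarith
  · intro y hy
    by_cases hyb : y ≤ gb
    · obtain ⟨t, ht, hty⟩ := hs ⟨hy.1, hyb⟩
      exact ⟨t, ⟨ht.1, ht.2.trans hba.le⟩, by simp only; rw [e0 t ht.2, hty]⟩
    · push Not at hyb
      have h2 : (y - gb) / c ≤ a - b := by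
        rw [div_le_iff₀ hc]; linarith [hy.2]
      have h3 : 0 ≤ (y - gb) / c := div_nonneg (by linarith) hc.le
      refine ⟨b + (y - gb) / c, ⟨by linarith, by linarith⟩, ?_⟩
      simp only; rw [e1 _ (by linarith)]
      field_simp; ring
  · intro t ht
    simp only
    by_cases htb : t < b
    · rw [e0 t htb.le]; exact hf t ⟨ht.1, htb⟩
    · push Not at htb
      rw [e1 t htb]
      apply hosc _ ⟨htb, ht.2⟩
      apply hpt
      · have : 0 ≤ (t - b) * c := mul_nonneg (sub_nonneg.2 htb) hc.le
        linarith
      · have := mul_lt_mul_of_pos_right (sub_lt_sub_right ht.2 b) hc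
        linarith
  · intro t ht
    simp only
    by_cases htb : t ≤ b
    · rw [e0 t htb]; exact hl t ⟨ht.1, htb⟩
    · push Not at htb
      rw [e1 t htb.le]
      obtain ⟨θ, hθ⟩ : ∃ θ, θ = (t - b) / (a - b) := ⟨_, rfl⟩
      have hθ0 : 0 ≤ θ := hθ ▸ div_nonneg (by linarith) hab.le
      have hθ1 : θ ≤ 1 := by rw [hθ, div_le_one hab]; linarith [ht.2]
      have ht' : t - b = θ * (a - b) := by rw [hθ, div_mul_cancel₀ _ hab.ne']
      have h3 : gb + (t - b) * c - t = (1 - θ) * (gb - b) + θ * (ga - a) := by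
        have : (t - b) * c = θ * (ga - gb) := by rw [ht', mul_assoc, mul_comm _ c, hca]
        rw [this]
        have : t = b + θ * (a - b) := by linarith
        rw [this]; ring
      rw [h3, abs_of_nonneg (add_nonneg (mul_nonneg (by linarith) (by linarith)) (mul_nonneg hθ0 (by linarith)))]
      nlinarith

lemma Pgood_T {d : ℕ} {T : ℝ} (hT : 0 < T) {f : ℝ → E d} (hf : IsCadlagOn d T f) {ε : ℝ}
    (hε : 0 < ε) : Pgood T f ε T := by
  set A := {a | a ∈ Icc 0 T ∧ Pgood T f ε a} with hA
  have h0 : (0:ℝ) ∈ A := ⟨⟨le_rfl, hT.le⟩, Pgood_zero T hT f ε⟩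
  have hbdd : BddAbove A := ⟨T, fun a ha => ha.1.2⟩
  obtain ⟨s, hs⟩ : ∃ s, s = sSup A := ⟨_, rfl⟩
  have hs0 : 0 ≤ s := hs ▸ le_csSup hbdd h0
  have hsT : s ≤ T := hs ▸ csSup_le ⟨0, h0⟩ fun a ha => ha.1.2
  have osc : ∀ {l : Filter ℝ} {y : E d}, Tendsto f l (nhds y) →
      ∀ᶠ t in l, ‖f t - y‖ ≤ ε / 2 := by
    intro l y h
    have := h.eventually (Metric.closedBall_mem_nhds y (half_pos hε))
    filter_upwards [this] with t ht
    rwa [dist_eq_norm] at ht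
  have tri : ∀ x y z : E d, ‖x - z‖ ≤ ε / 2 → ‖y - z‖ ≤ ε / 2 → ‖x - y‖ ≤ ε := by
    intro x y z h1 h2
    calc ‖x - y‖ = ‖(x - z) - (y - z)‖ := by congr 1; abel
      _ ≤ ‖x - z‖ + ‖y - z‖ := norm_sub_le _ _
      _ ≤ ε := by linarith
  have hPs : Pgood T f ε s := by
    rcases hs0.eq_or_lt with h | hpos
    · rw [← h]; exact h0.2
    · obtain ⟨y, hy⟩ := hf.2 s ⟨hpos, hsT⟩
      have := osc hy
      rw [eventually_nhdsWithin_iff, Metric.eventually_nhds_iff] at this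
      obtain ⟨δ, hδ, hball⟩ := this
      obtain ⟨b, hbA, hb⟩ := exists_lt_of_lt_csSup ⟨0, h0⟩ (show s - δ < sSup A by rw [← hs]; linarith)
      have hbs : b ≤ s := hs ▸ le_csSup hbdd hbA
      rcases hbs.eq_or_lt with h | hlt
      · rw [← h]; exact hbA.2
      · refine Pgood_step T hT f ε hbA.1.1 hlt ?_ hbA.2
        have key : ∀ t ∈ Ico b s, ‖f t - y‖ ≤ ε / 2 := by
          intro t ht
          apply hball
          · rw [Real.dist_eq, abs_lt]; constructor <;> linarith [ht.1, ht.2]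
          · exact ⟨hbA.1.1.trans ht.1, ht.2⟩
        exact fun t ht u hu => tri _ _ _ (key t ht) (key u hu)
  rcases hsT.eq_or_lt with h | hlt
  · rw [h] at hPs; exact hPs
  exfalso
  have := osc (hf.1 s ⟨hs0, hlt⟩)
  rw [eventually_nhdsWithin_iff, Metric.eventually_nhds_iff] at this
  obtain ⟨δ, hδ, hball⟩ := this
  obtain ⟨a, ha1, ha2⟩ : ∃ a, s < a ∧ a < min (s + δ) T := exists_between (lt_min (by linarith) hlt)
  rw [lt_min_iff] at ha2
  have : Pgood T f ε a := by
    refine Pgood_step T hT f ε hs0 ha1 ?_ hPs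
    have key : ∀ t ∈ Ico s a, ‖f t - f s‖ ≤ ε / 2 := by
      intro t ht
      rcases ht.1.eq_or_lt with h | h
      · rw [← h]; simp; positivity
      apply hball
      · rw [Real.dist_eq, abs_lt]; constructor <;> linarith [ht.1, ht.2, ha2.1]
      · exact ⟨h, ht.2.trans ha2.2⟩
    exact fun t ht u hu => tri _ _ _ (key t ht) (key u hu)
  have : a ≤ sSup A := le_csSup hbdd ⟨⟨hs0.trans ha1.le, ha2.2.le⟩, this⟩
  linarith

def tau (T : ℝ) (n j : ℕ) : ℝ := if j < n then T / (n + 1) * j else T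

lemma skor_approx {d : ℕ} {T : ℝ} (hT : 0 < T) {f : ℝ → E d} (hf : f ∈ DReal d T) :
    Tendsto (fun n : ℕ => skorokhodDist d T f
      (stepPath (T / (n + 1)) n (fun j => f (tau T n j)))) atTop (nhds 0) := by
  have hlim : Tendsto (fun n : ℕ => T / ((n : ℝ) + 1)) atTop (nhds 0) :=
    tendsto_const_div_atTop_nhds_zero_nat T |>.comp (tendsto_add_atTop_nat 1) |>.congr
      (fun n => by simp)
  rw [Metric.tendsto_atTop']
  suffices H : ∀ ε > 0, ∀ᶠ n : ℕ in atTop, skorokhodDist d T f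
      (stepPath (T / (n + 1)) n (fun j => f (tau T n j))) ≤ 3 * ε by
    intro ε hε
    obtain ⟨N, hN⟩ := eventually_atTop.1 (H (ε / 4) (by positivity))
    refine ⟨N, fun n hn => ?_⟩
    rw [Real.dist_eq, sub_zero, abs_of_nonneg (skor_nonneg hT _ _)]
    linarith [hN n hn.le]
  intro ε hε
  have hend : ∀ᶠ n : ℕ in atTop, ‖f (T / (n + 1) * n) - f T‖ ≤ ε := by
    have h1 : Tendsto (fun n : ℕ => T / ((n : ℝ) + 1) * n) atTop (nhdsWithin T (Ico 0 T)) := by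
      apply tendsto_nhdsWithin_of_tendsto_nhds_of_eventually_within
      · have : Tendsto (fun n : ℕ => T - T / ((n : ℝ) + 1)) atTop (nhds (T - 0)) :=
          tendsto_const_nhds.sub hlim
        rw [sub_zero] at this
        refine this.congr fun n => ?_
        field_simp; ring
      · exact Eventually.of_forall fun n => ⟨by positivity, hn_lt hT n⟩
    have := (hf.2.1.comp h1).eventually (Metric.closedBall_mem_nhds (f T) hε)
    filter_upwards [this] with n hn
    rwa [dist_eq_norm] at hn
  filter_upwards [Pgood_T hT hf.1 hε, hend, hlim.eventually (gt_mem_nhds hε)] with n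
    ⟨lam, hm, h0, hlb, hs, hf', hl⟩ hn hn2
  have hh : 0 < T / ((n : ℝ) + 1) := by positivity
  have hTT : T / ((n : ℝ) + 1) * (⌈T / (T / ((n : ℝ) + 1))⌉₊ : ℝ) = T := by
    have : T / (T / ((n : ℝ) + 1)) = ((n + 1 : ℕ) : ℝ) := by
      push_cast; field_simp
    rw [this, Nat.ceil_natCast]; push_cast; field_simp
  rw [hTT] at hlb hs
  have hmap : MapsTo lam (Icc 0 T) (Icc 0 T) := by
    intro t ht
    constructor
    · rw [← h0]; exact hm.monotoneOn ⟨le_rfl, hT.le⟩ ht ht.1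
    · rw [← hlb]; exact hm.monotoneOn ht ⟨hT.le, le_rfl⟩ ht.2
  apply skor_le hT lam hm ⟨hmap, hm.injOn, hs⟩
  intro t ht
  have h1 : |lam t - t| ≤ ε := (hl t ht).trans hn2.le
  suffices ‖f t - stepPath (T / (n + 1)) n (fun j => f (tau T n j)) (lam t)‖ ≤ 2 * ε by linarith
  rcases ht.2.eq_or_lt with h | hlt
  · rw [h, hlb, stepPath_T hT n _ (hn_lt hT n).le]
    simp [tau, hε.le]
  · have hft := hf' t ⟨ht.1, hlt⟩
    set k := ⌊lam t / (T / ((n : ℝ) + 1))⌋₊ with hk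
    unfold stepPath
    rw [← hk]
    rcases lt_or_ge k n with hkn | hkn
    · rw [min_eq_left hkn.le]; simp only [tau, hkn, if_true]; linarith
    · rw [min_eq_right hkn]; simp only [tau, lt_irrefl, if_false]
      have : k = n := by
        have : k < n + 1 := by
          rw [hk, Nat.floor_lt (div_nonneg (hmap ht).1 hh.le), div_lt_iff₀ hh]
          have h3 : lam t < T := by rw [← hlb]; exact hm ht ⟨hT.le, le_rfl⟩ hlt
          push_cast
          have : ((n:ℝ) + 1) * (T / ((n : ℝ) + 1)) = T := by field_simp
          linarith
        omega
      rw [this] at hft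
      calc ‖f t - f T‖ = ‖(f t - f (T / (n + 1) * n)) + (f (T / (n + 1) * n) - f T)‖ := by
            congr 1; abel
        _ ≤ _ := norm_add_le _ _
        _ ≤ _ := by linarith


lemma exists_coupling_eq_mass {X : Type*} [MeasurableSpace X] (α β : Measure X) [IsFiniteMeasure α]
    [IsFiniteMeasure β] (h : α univ = β univ) :
    ∃ γ : Measure (X × X), γ.map Prod.fst = α ∧ γ.map Prod.snd = β := by
  rcases eq_or_ne (α univ) 0 with h0 | h0
  · refine ⟨0, ?_, ?_⟩
    · have := Measure.measure_univ_eq_zero.1 h0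
      rw [Measure.map_zero, this]
    · have := Measure.measure_univ_eq_zero.1 (h ▸ h0)
      rw [Measure.map_zero, this]
  · have hi : (α univ)⁻¹ * α univ = 1 := ENNReal.inv_mul_cancel h0 (measure_ne_top _ _)
    refine ⟨(α univ)⁻¹ • α.prod β, ?_, ?_⟩
    · rw [Measure.map_smul, Measure.map_fst_prod, smul_smul, ← h, hi, one_smul]
    · rw [Measure.map_smul, Measure.map_snd_prod, smul_smul, hi, one_smul]

/-- half of the decomposition -/
lemma decomp_half {X ι : Type*} [MeasurableSpace X] [Fintype ι] (ν : Measure X)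
    [IsProbabilityMeasure ν] (φ : ι → X → ℝ≥0∞) (hφ : ∀ i, Measurable (φ i))
    (hsum : ∀ x, ∑ i, φ i x ≤ 1) (g : X → ℝ≥0∞) (hg : Measurable g) (K : ℝ≥0∞)
    (hK : ∀ i x, φ i x ≠ 0 → g x ≤ K) (b : ι → ℝ≥0∞) :
    ∃ (ν' : ι → Measure X) (ν0 : Measure X), ν0 + ∑ i, ν' i = ν ∧
      (∀ i, ν' i univ = min (∫⁻ x, φ i x ∂ν) (b i)) ∧
      (∀ i, ∀ᵐ x ∂(ν' i), φ i x ≠ 0) ∧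
      ∫⁻ x, g x ∂ν0 ≤ ∫⁻ x, g x * (1 - ∑ i, φ i x) ∂ν + K * ∑ i, (∫⁻ x, φ i x ∂ν - b i) := by
  set a := fun i => ∫⁻ x, φ i x ∂ν with ha
  have ha1 : ∀ i, a i ≤ 1 := by
    intro i
    calc a i ≤ ∫⁻ x, 1 ∂ν := lintegral_mono fun x =>
          (Finset.single_le_sum (f := fun i => φ i x) (fun _ _ => zero_le) (Finset.mem_univ i)).trans (hsum x)
      _ = 1 := by simp
  have hat : ∀ i, a i ≠ ∞ := fun i => ((ha1 i).trans_lt ENNReal.one_lt_top).ne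
  set r := fun i => min (a i) (b i) / a i with hr
  have hr1 : ∀ i, r i ≤ 1 := fun i => ENNReal.div_le_of_le_mul (by simp)
  have hra : ∀ i, r i * a i = min (a i) (b i) := by
    intro i
    apply ENNReal.div_mul_cancel' _ (fun h => absurd h (hat i))
    intro h; simp [h]
  have hms : Measurable fun x => ∑ i, φ i x := Finset.measurable_sum _ fun i _ => hφ i
  refine ⟨fun i => r i • ν.withDensity (φ i),
    ν.withDensity (fun x => 1 - ∑ i, φ i x) + ∑ i, (1 - r i) • ν.withDensity (φ i), ?_, ?_, ?_, ?_⟩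
  · have h1 : ∑ i, (1 - r i) • ν.withDensity (φ i) + ∑ i, r i • ν.withDensity (φ i)
        = ν.withDensity (fun x => ∑ i, φ i x) := by
      rw [← Finset.sum_add_distrib]
      have : ∀ i, (1 - r i) • ν.withDensity (φ i) + r i • ν.withDensity (φ i)
          = ν.withDensity (φ i) := fun i => by
        rw [← add_smul, tsub_add_cancel_of_le (hr1 i), one_smul]
      simp only [this]
      ext s hs
      rw [withDensity_apply _ hs, lintegral_finsetSum _ fun i _ => hφ i, Measure.finsetSum_apply]
      simp [withDensity_apply _ hs]
    rw [add_assoc, h1, ← withDensity_add_right _ hms]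
    have : ((fun x => 1 - ∑ i, φ i x) + fun x => ∑ i, φ i x) = fun _ => 1 := by
      ext x; exact tsub_add_cancel_of_le (hsum x)
    rw [this]; simp
  · intro i
    simp only [Measure.smul_apply, smul_eq_mul]
    rw [withDensity_apply _ MeasurableSet.univ, Measure.restrict_univ]
    exact hra i
  · intro i
    apply Measure.ae_smul_measure
    rw [ae_withDensity_iff (hφ i)]
    exact Eventually.of_forall fun x h => h
  · rw [lintegral_add_measure, lintegral_finsetSum_measure]
    apply add_le_add
    · rw [lintegral_withDensity_eq_lintegral_mul _ (show Measurable fun x => 1 - ∑ i, φ i x from measurable_const.sub hms) hg]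
      exact le_of_eq (lintegral_congr fun x => by simp [mul_comm])
    · rw [Finset.mul_sum]
      apply Finset.sum_le_sum
      intro i _
      rw [lintegral_smul_measure, lintegral_withDensity_eq_lintegral_mul _ (hφ i) hg]
      have h2 : ∫⁻ x, (φ i * g) x ∂ν ≤ K * a i := by
        rw [ha]
        simp only
        rw [← lintegral_const_mul _ (hφ i)]
        apply lintegral_mono
        intro x
        simp only [Pi.mul_apply]
        by_cases hx : φ i x = 0
        · simp [hx]
        · rw [mul_comm]; gcongr; exact hK i x hx
      calc (1 - r i) • ∫⁻ x, (φ i * g) x ∂ν ≤ (1 - r i) * (K * a i) := by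
            rw [smul_eq_mul]; gcongr
        _ = K * ((1 - r i) * a i) := by ring
        _ = K * (a i - min (a i) (b i)) := by
            rw [ENNReal.sub_mul (fun _ _ => hat i), one_mul, hra]
        _ ≤ K * (a i - b i) := by
            refine mul_le_mul' le_rfl ?_
            rcases le_total (a i) (b i) with h | h
            · rw [min_eq_left h]; simp
            · rw [min_eq_right h]

lemma coupling_bound {X ι : Type*} [PseudoEMetricSpace X] [SecondCountableTopology X]
    [MeasurableSpace X] [BorelSpace X] [Fintype ι] (ν μ : Measure X)
    [IsProbabilityMeasure ν] [IsProbabilityMeasure μ] (φ : ι → X → ℝ≥0∞) (hφ : ∀ i, Measurable (φ i))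
    (hsum : ∀ x, ∑ i, φ i x ≤ 1) (g : X → ℝ≥0∞) (hg : Measurable g) (K : ℝ≥0∞)
    (hK : ∀ i x, φ i x ≠ 0 → g x ≤ K) (ε : ℝ≥0∞)
    (hd : ∀ i x y, φ i x ≠ 0 → φ i y ≠ 0 → edist x y ≤ ε) (hgd : ∀ x y, edist x y ≤ g x + g y) :
    ∃ π : Measure (X × X), π.map Prod.fst = ν ∧ π.map Prod.snd = μ ∧
      ∫⁻ p, edist p.1 p.2 ∂π ≤ ε +
        ((∫⁻ x, g x * (1 - ∑ i, φ i x) ∂ν + K * ∑ i, (∫⁻ x, φ i x ∂ν - ∫⁻ x, φ i x ∂μ)) +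
        (∫⁻ x, g x * (1 - ∑ i, φ i x) ∂μ + K * ∑ i, (∫⁻ x, φ i x ∂μ - ∫⁻ x, φ i x ∂ν))) := by
  obtain ⟨ν', ν0, e1, m1, s1, c1⟩ := decomp_half ν φ hφ hsum g hg K hK (fun i => ∫⁻ x, φ i x ∂μ)
  obtain ⟨μ', μ0, e2, m2, s2, c2⟩ := decomp_half μ φ hφ hsum g hg K hK (fun i => ∫⁻ x, φ i x ∂ν)
  have mm : ∀ i, ν' i univ = μ' i univ := fun i => by rw [m1, m2, min_comm]
  have t1 : ν0 univ + ∑ i, ν' i univ = 1 := by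
    have := congrArg (fun m : Measure X => m univ) e1
    simpa [Measure.finsetSum_apply] using this
  have t2 : μ0 univ + ∑ i, μ' i univ = 1 := by
    have := congrArg (fun m : Measure X => m univ) e2
    simpa [Measure.finsetSum_apply] using this
  have : IsFiniteMeasure ν0 :=
    ⟨(le_self_add.trans_eq t1).trans_lt ENNReal.one_lt_top⟩
  have : IsFiniteMeasure μ0 :=
    ⟨(le_self_add.trans_eq t2).trans_lt ENNReal.one_lt_top⟩
  have : ∀ i, IsFiniteMeasure (ν' i) := fun i => ⟨(((Finset.single_le_sum (f := fun i => ν' i univ)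
    (fun _ _ => zero_le) (Finset.mem_univ i)).trans le_add_self).trans_eq t1).trans_lt ENNReal.one_lt_top⟩
  have : ∀ i, IsFiniteMeasure (μ' i) := fun i => ⟨mm i ▸ (measure_lt_top (ν' i) univ)⟩
  have m0 : ν0 univ = μ0 univ := by
    simp only [← mm] at t2
    have hfin : ∑ i, ν' i univ ≠ ∞ := by
      intro h; rw [h] at t1; simp at t1
    exact (ENNReal.add_left_inj hfin).1 (t1.trans t2.symm)
  obtain ⟨γ0, f0, g0⟩ := exists_coupling_eq_mass ν0 μ0 m0
  choose γ f1 g1 using fun i => exists_coupling_eq_mass (ν' i) (μ' i) (mm i)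
  have mapsum : ∀ (p : X × X → X), Measurable p →
      (∑ i, γ i).map p = ∑ i, (γ i).map p := by
    intro p hp
    ext s hs
    rw [Measure.map_apply hp hs, Measure.finsetSum_apply, Measure.finsetSum_apply]
    simp [Measure.map_apply hp hs]
  refine ⟨γ0 + ∑ i, γ i, ?_, ?_, ?_⟩
  · rw [Measure.map_add _ _ measurable_fst, mapsum _ measurable_fst, f0]; simp only [f1]; exact e1
  · rw [Measure.map_add _ _ measurable_snd, mapsum _ measurable_snd, g0]; simp only [g1]; exact e2
  · rw [lintegral_add_measure, lintegral_finsetSum_measure, add_comm]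
    apply add_le_add
    · calc ∑ i, ∫⁻ p, edist p.1 p.2 ∂(γ i) ≤ ∑ i, ε * ν' i univ := by
            apply Finset.sum_le_sum
            intro i _
            have hn : MeasurableSet {x | φ i x ≠ 0} := (hφ i (measurableSet_singleton 0)).compl
            have h1 : ∀ᵐ p ∂(γ i), φ i p.1 ≠ 0 :=
              (ae_map_iff measurable_fst.aemeasurable hn).1 (by rw [f1]; exact s1 i)
            have h2 : ∀ᵐ p ∂(γ i), φ i p.2 ≠ 0 :=
              (ae_map_iff measurable_snd.aemeasurable hn).1 (by rw [g1]; exact s2 i)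
            calc ∫⁻ p, edist p.1 p.2 ∂(γ i) ≤ ∫⁻ _, ε ∂(γ i) := by
                  apply lintegral_mono_ae
                  filter_upwards [h1, h2] with p hp1 hp2 using hd i _ _ hp1 hp2
              _ = ε * ν' i univ := by
                  rw [lintegral_const, ← f1 i, Measure.map_apply measurable_fst MeasurableSet.univ, preimage_univ]
        _ = ε * ∑ i, ν' i univ := by rw [Finset.mul_sum]
        _ ≤ ε * 1 := by gcongr; rw [← t1]; exact le_add_self
        _ = ε := mul_one _
    · calc ∫⁻ p, edist p.1 p.2 ∂γ0 ≤ ∫⁻ p, (g p.1 + g p.2) ∂γ0 := lintegral_mono fun p => hgd _ _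
        _ = ∫⁻ x, g x ∂ν0 + ∫⁻ x, g x ∂μ0 := by
            rw [lintegral_add_left (show Measurable fun p : X × X => g p.1 from hg.comp measurable_fst), ← f0, ← g0,
              lintegral_map hg measurable_fst, lintegral_map hg measurable_snd]
        _ ≤ _ := add_le_add c1 c2


def l1 {d : ℕ} (x : E d) : ℝ := ∑ k, |x k|

lemma l1_nonneg {d : ℕ} (x : E d) : 0 ≤ l1 x := Finset.sum_nonneg fun _ _ => abs_nonneg _

lemma l1_cont {d : ℕ} : Continuous (l1 : E d → ℝ) := by unfold l1; fun_prop

lemma norm_le_l1 {d : ℕ} (x : E d) : ‖x‖ ≤ l1 x := by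
  rw [EuclideanSpace.norm_eq]
  apply Real.sqrt_le_iff.2 ⟨l1_nonneg x, ?_⟩
  simp only [Real.norm_eq_abs]
  exact Finset.sum_sq_le_sq_sum_of_nonneg fun i _ => abs_nonneg _

lemma l1_le {d : ℕ} (x : E d) : l1 x ≤ d * ‖x‖ := by
  calc l1 x ≤ ∑ _k : Fin d, ‖x‖ := Finset.sum_le_sum fun k _ => by
        simpa using PiLp.norm_apply_le x k
    _ = d * ‖x‖ := by simp

lemma coord_int {d : ℕ} {ν : Measure (E d)} (h : Integrable (id : E d → E d) ν) (k : Fin d) :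
    Integrable (fun x : E d => x k) ν :=
  (EuclideanSpace.proj (𝕜 := ℝ) k).integrable_comp h

lemma l1_int {d : ℕ} {ν : Measure (E d)} (h : Integrable (id : E d → E d) ν) :
    Integrable (l1 : E d → ℝ) ν :=
  integrable_finsetSum _ fun k _ => (coord_int h k).abs

lemma l1_lim {d : ℕ} 
    (ν : ℕ → Measure (E d)) 
    (hνint : ∀ n, Integrable (id : E d → E d) (ν n))
    (hνbary : ∀ n, ∀ k : Fin d, ∫ x, x k ∂(ν n) = 1)
    (μ : Measure (E d)) 
    (hμsupp : μ ({x : E d | ∀ i, 0 < x i}ᶜ) = 0)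
    (hμint : Integrable (id : E d → E d) μ)
    (hμbary : ∀ k : Fin d, ∫ x, x k ∂μ = 1)
    (hneg : ∀ k : Fin d,
      Tendsto (fun n => ∫ x, max (-(x k)) 0 ∂(ν n)) atTop (nhds 0)) :
    Tendsto (fun n => ∫ x, l1 x ∂(ν n)) atTop (nhds (∫ x, l1 x ∂μ)) := by
  unfold l1
  have e : ∀ n, ∫ x, ∑ k, |x k| ∂(ν n) = ∑ k, ∫ x, |x k| ∂(ν n) := fun n =>
    integral_finsetSum _ fun k _ => (coord_int (hνint n) k).abs
  simp only [e]
  rw [integral_finsetSum _ fun k _ => (coord_int hμint k).abs]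
  apply tendsto_finsetSum
  intro k _
  have h1 : ∫ x, |x k| ∂μ = 1 := by
    rw [← hμbary k]
    apply integral_congr_ae
    have : ∀ᵐ x ∂μ, ∀ i, 0 < x i := hμsupp
    filter_upwards [this] with x hx using abs_of_pos (hx k)
  have h2 : ∀ n, ∫ x, |x k| ∂(ν n) = 1 + 2 * ∫ x, max (-(x k)) 0 ∂(ν n) := by
    intro n
    rw [← hνbary n k, ← integral_const_mul, ← integral_add (coord_int (hνint n) k)
      (show Integrable (fun x : E d => 2 * max (-(x k)) 0) (ν n) from
        ((coord_int (hνint n) k).neg.pos_part).const_mul 2)]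
    congr 1; ext x
    rcases le_total 0 (x k) with h | h
    · rw [abs_of_nonneg h, max_eq_right (by linarith)]; ring
    · rw [abs_of_nonpos h, max_eq_left (by linarith)]; ring
  simp only [h1, h2]
  have := ((hneg k).const_mul 2).const_add 1
  simpa using this

lemma tail_small {d : ℕ} (μ : Measure (E d)) 
    (hμint : Integrable (id : E d → E d) μ) {δ : ℝ} (hδ : 0 < δ) :
    ∃ R : ℝ, 0 ≤ R ∧ ∫ x, {x : E d | R < ‖x‖}.indicator l1 x ∂μ < δ := by
  have : Tendsto (fun n : ℕ => ∫ x, {x : E d | (n:ℝ) < ‖x‖}.indicator l1 x ∂μ) atTop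
      (nhds (∫ _, (0:ℝ) ∂μ)) := by
    apply tendsto_integral_of_dominated_convergence l1
    · intro n
      apply (l1_cont.aestronglyMeasurable).indicator
      exact measurableSet_lt measurable_const measurable_norm
    · exact l1_int hμint
    · intro n
      refine Eventually.of_forall fun x => ?_
      refine (norm_indicator_le_norm_self _ _).trans ?_
      rw [Real.norm_of_nonneg (l1_nonneg x)]
    · refine Eventually.of_forall fun x => ?_
      apply tendsto_nhds_of_eventually_eq
      filter_upwards [tendsto_natCast_atTop_atTop.eventually_ge_atTop ‖x‖] with n hn
      apply indicator_of_notMem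
      simpa using hn
  simp only [integral_zero] at this
  obtain ⟨n, hn⟩ := (this.eventually (gt_mem_nhds hδ)).exists
  exact ⟨n, by positivity, hn⟩

lemma exists_partition {d : ℕ} {R δ : ℝ} (hδ : 0 < δ) :
    ∃ (t : Finset (E d)) (φ : t → E d → ℝ), (∀ i, Continuous (φ i)) ∧ (∀ i x, 0 ≤ φ i x) ∧
      (∀ x, ∑ i, φ i x ≤ 1) ∧ (∀ x, ‖x‖ ≤ R → ∑ i, φ i x = 1) ∧
      (∀ i x, φ i x ≠ 0 → dist x i.1 ≤ δ ∧ ‖x‖ ≤ R + δ) := by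
  obtain ⟨t, htR, htf, hcov⟩ := (isCompact_closedBall (0 : E d) R).finite_cover_balls (half_pos hδ)
  lift t to Finset (E d) using htf
  set ψ : t → E d → ℝ := fun i x => max 0 (δ - dist x i.1) with hψ
  have ψ0 : ∀ i x, 0 ≤ ψ i x := fun i x => le_max_left _ _
  have dpos : ∀ x, 0 < max (δ / 2) (∑ j, ψ j x) := fun x => lt_max_of_lt_left (half_pos hδ)
  refine ⟨t, fun i x => ψ i x / max (δ / 2) (∑ j, ψ j x), ?_, ?_, ?_, ?_, ?_⟩
  · intro i
    refine Continuous.div (by fun_prop) (by fun_prop) fun x => (dpos x).ne'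
  · intro i x; exact div_nonneg (ψ0 i x) (dpos x).le
  · intro x
    rw [← Finset.sum_div, div_le_one (dpos x)]; exact le_max_right _ _
  · intro x hx
    have hx' := hcov (show x ∈ Metric.closedBall 0 R by simpa using hx)
    simp only [mem_iUnion, Metric.mem_ball, exists_prop] at hx'
    obtain ⟨y, hy, hxy⟩ := hx'
    have : δ / 2 ≤ ∑ j, ψ j x := by
      calc δ / 2 ≤ ψ ⟨y, hy⟩ x := le_max_of_le_right (by simp only; linarith)
        _ ≤ _ := Finset.single_le_sum (f := fun j => ψ j x) (fun j _ => ψ0 j x) (Finset.mem_univ _)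
    rw [← Finset.sum_div, max_eq_right this, div_self (by linarith)]
  · intro i x hx
    have h1 : ψ i x ≠ 0 := fun h => hx (by simp [h])
    have h2 : dist x i.1 ≤ δ := by
      by_contra hc
      exact h1 (max_eq_left (by linarith))
    refine ⟨h2, ?_⟩
    have h3 : ‖i.1‖ ≤ R := by simpa using htR i.2
    calc ‖x‖ = ‖(x - i.1) + i.1‖ := by simp
      _ ≤ ‖x - i.1‖ + ‖i.1‖ := norm_add_le _ _
      _ ≤ R + δ := by rw [← dist_eq_norm]; linarith

lemma exists_coupling_small {d : ℕ} 
    (ν : ℕ → Measure (E d)) (hνprob : ∀ n, IsProbabilityMeasure (ν n))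
    (hνint : ∀ n, Integrable (id : E d → E d) (ν n))
    (hνbary : ∀ n, ∀ k : Fin d, ∫ x, x k ∂(ν n) = 1)
    (μ : Measure (E d)) (hμprob : IsProbabilityMeasure μ)
    (hμsupp : μ ({x : E d | ∀ i, 0 < x i}ᶜ) = 0)
    (hμint : Integrable (id : E d → E d) μ)
    (hμbary : ∀ k : Fin d, ∫ x, x k ∂μ = 1)
    (hweak : ∀ f : BoundedContinuousFunction (E d) ℝ,
      Tendsto (fun n => ∫ x, f x ∂(ν n)) atTop (nhds (∫ x, f x ∂μ)))
    (hneg : ∀ k : Fin d,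
      Tendsto (fun n => ∫ x, max (-(x k)) 0 ∂(ν n)) atTop (nhds 0)) {ε : ℝ} (hε : 0 < ε) :
    ∀ᶠ n in atTop, ∃ π : Measure (E d × E d), π.map Prod.fst = ν n ∧ π.map Prod.snd = μ ∧
      ∫⁻ p, edist p.1 p.2 ∂π ≤ ENNReal.ofReal ε := by
  obtain ⟨R, hR, htail⟩ := tail_small μ hμint (show 0 < ε / 8 by positivity)
  obtain ⟨t, φ, φc, φ0, φs, φ1, φd⟩ := exists_partition (d := d) (R := R) (show 0 < ε / 8 by positivity)
  have φle : ∀ i x, φ i x ≤ 1 := fun i x =>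
    (Finset.single_le_sum (f := fun j => φ j x) (fun j _ => φ0 j x) (Finset.mem_univ i)).trans (φs x)
  set K : ℝ := d * (R + ε / 8) with hKdef
  have hK0 : 0 ≤ K := by positivity
  have hK : ∀ i x, φ i x ≠ 0 → l1 x ≤ K := fun i x h =>
    (l1_le x).trans (mul_le_mul_of_nonneg_left (φd i x h).2 (by positivity))
  -- bounded continuous test functions
  have lim1 : ∀ i, Tendsto (fun n => ∫ x, φ i x ∂(ν n)) atTop (nhds (∫ x, φ i x ∂μ)) := fun i =>
    hweak (BoundedContinuousFunction.ofNormedAddCommGroup (φ i) (φc i) 1 fun x => by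
      rw [Real.norm_of_nonneg (φ0 i x)]; exact φle i x)
  have Φc : Continuous fun x => ∑ i, φ i x := by fun_prop
  have Φb : ∀ x, ‖l1 x * ∑ i, φ i x‖ ≤ K := by
    intro x
    rw [Real.norm_of_nonneg (mul_nonneg (l1_nonneg x) (Finset.sum_nonneg fun i _ => φ0 i x))]
    by_cases h : ∃ i, φ i x ≠ 0
    · obtain ⟨i, hi⟩ := h
      calc l1 x * ∑ i, φ i x ≤ K * 1 := mul_le_mul (hK i x hi) (φs x)
            (Finset.sum_nonneg fun i _ => φ0 i x) hK0
        _ = K := mul_one K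
    · push Not at h
      simp [h, hK0]
  have lim2 : Tendsto (fun n => ∫ x, l1 x * ∑ i, φ i x ∂(ν n)) atTop
      (nhds (∫ x, l1 x * ∑ i, φ i x ∂μ)) :=
    hweak (BoundedContinuousFunction.ofNormedAddCommGroup _ (l1_cont.mul Φc) K Φb)
  have lim3 := l1_lim ν hνint hνbary μ hμsupp hμint hμbary hneg
  have int2 : ∀ (m : Measure (E d)) [IsProbabilityMeasure m],
      Integrable (fun x => l1 x * ∑ i, φ i x) m := fun m _ =>
    Integrable.of_bound (l1_cont.mul Φc).aestronglyMeasurable K (Eventually.of_forall Φb)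
  have int3 : ∀ (m : Measure (E d)) [IsProbabilityMeasure m], Integrable (id : E d → E d) m →
      Integrable (fun x => l1 x - l1 x * ∑ i, φ i x) m := fun m _ hm => (l1_int hm).sub (int2 m)
  -- transfer to lintegrals
  have tr1 : ∀ (m : Measure (E d)) [IsProbabilityMeasure m] (i),
      ∫⁻ x, ENNReal.ofReal (φ i x) ∂m = ENNReal.ofReal (∫ x, φ i x ∂m) := fun m _ i =>
    (ofReal_integral_eq_lintegral_ofReal (Integrable.of_bound (φc i).aestronglyMeasurable 1
      (Eventually.of_forall fun x => by rw [Real.norm_of_nonneg (φ0 i x)]; exact φle i x))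
      (Eventually.of_forall (φ0 i))).symm
  have tr2 : ∀ (m : Measure (E d)) [IsProbabilityMeasure m], Integrable (id : E d → E d) m →
      ∫⁻ x, ENNReal.ofReal (l1 x) * (1 - ∑ i, ENNReal.ofReal (φ i x)) ∂m
        = ENNReal.ofReal (∫ x, l1 x ∂m - ∫ x, l1 x * ∑ i, φ i x ∂m) := by
    intro m _ hm
    rw [← integral_sub (l1_int hm) (int2 m), ofReal_integral_eq_lintegral_ofReal (int3 m hm)]
    · congr 1; ext x
      rw [← ENNReal.ofReal_sum_of_nonneg fun i _ => φ0 i x, ← ENNReal.ofReal_one,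
        ← ENNReal.ofReal_sub _ (Finset.sum_nonneg fun i _ => φ0 i x),
        ← ENNReal.ofReal_mul (l1_nonneg x)]
      congr 1; ring
    · refine Eventually.of_forall fun x => ?_
      have := mul_le_mul_of_nonneg_left (φs x) (l1_nonneg x)
      simp only [Pi.zero_apply]
      linarith
  have tailμ : ∫ x, l1 x ∂μ - ∫ x, l1 x * ∑ i, φ i x ∂μ < ε / 8 := by
    refine lt_of_le_of_lt ?_ htail
    rw [← integral_sub (l1_int hμint) (int2 μ)]
    apply integral_mono (int3 μ hμint)
    · exact (l1_int hμint).indicator (measurableSet_lt measurable_const measurable_norm)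
    · intro x
      simp only [indicator, mem_ofPred_eq]
      split_ifs with h
      · have := mul_nonneg (l1_nonneg x) (Finset.sum_nonneg fun i (_ : i ∈ Finset.univ) => φ0 i x)
        linarith
      · rw [φ1 x (not_lt.1 h)]; simp
  have tl : Tendsto (fun n => ∫ x, l1 x ∂(ν n) - ∫ x, l1 x * ∑ i, φ i x ∂(ν n)) atTop
      (nhds (∫ x, l1 x ∂μ - ∫ x, l1 x * ∑ i, φ i x ∂μ)) := lim3.sub lim2
  have sl : ∀ i, Tendsto (fun n => ENNReal.ofReal (∫ x, φ i x ∂(ν n))) atTop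
      (nhds (ENNReal.ofReal (∫ x, φ i x ∂μ))) := fun i => ENNReal.tendsto_ofReal (lim1 i)
  have s1 : Tendsto (fun n => ENNReal.ofReal K * ∑ i, (ENNReal.ofReal (∫ x, φ i x ∂(ν n)) -
      ENNReal.ofReal (∫ x, φ i x ∂μ))) atTop (nhds 0) := by
    have : Tendsto (fun n => ∑ i, (ENNReal.ofReal (∫ x, φ i x ∂(ν n)) -
      ENNReal.ofReal (∫ x, φ i x ∂μ))) atTop (nhds (∑ _i : t, 0)) := by
      apply tendsto_finsetSum
      intro i _
      have := ENNReal.Tendsto.sub (sl i) (tendsto_const_nhds (x := ENNReal.ofReal (∫ x, φ i x ∂μ)))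
        (Or.inl ENNReal.ofReal_ne_top)
      simpa using this
    have := ENNReal.Tendsto.const_mul this (Or.inr (ENNReal.ofReal_ne_top (r := K)))
    simpa using this
  have s2 : Tendsto (fun n => ENNReal.ofReal K * ∑ i, (ENNReal.ofReal (∫ x, φ i x ∂μ) -
      ENNReal.ofReal (∫ x, φ i x ∂(ν n)))) atTop (nhds 0) := by
    have : Tendsto (fun n => ∑ i, (ENNReal.ofReal (∫ x, φ i x ∂μ) -
      ENNReal.ofReal (∫ x, φ i x ∂(ν n)))) atTop (nhds (∑ _i : t, 0)) := by
      apply tendsto_finsetSum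
      intro i _
      have := ENNReal.Tendsto.sub (tendsto_const_nhds (x := ENNReal.ofReal (∫ x, φ i x ∂μ))) (sl i)
        (Or.inl ENNReal.ofReal_ne_top)
      simpa using this
    have := ENNReal.Tendsto.const_mul this (Or.inr (ENNReal.ofReal_ne_top (r := K)))
    simpa using this
  have ev : ∀ {f : ℕ → ℝ≥0∞}, Tendsto f atTop (nhds 0) →
      ∀ᶠ n in atTop, f n ≤ ENNReal.ofReal (ε / 8) := fun h =>
    (h.eventually (gt_mem_nhds (by simp [hε]))).mono fun n hn => hn.le
  filter_upwards [ev s1, ev s2, tl.eventually (gt_mem_nhds tailμ)] with n h1 h2 h3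
  have := hνprob n
  obtain ⟨π, p1, p2, p3⟩ := coupling_bound (ν n) μ (fun i x => ENNReal.ofReal (φ i x))
    (fun i => (φc i).measurable.ennreal_ofReal) (fun x => by
      rw [← ENNReal.ofReal_sum_of_nonneg fun i _ => φ0 i x]
      exact ENNReal.ofReal_le_one.2 (φs x))
    (fun x => ENNReal.ofReal (l1 x)) l1_cont.measurable.ennreal_ofReal (ENNReal.ofReal K)
    (fun i x h => ENNReal.ofReal_le_ofReal (hK i x (fun h0 => h (by simp [h0]))))
    (ENNReal.ofReal (ε / 4))
    (fun i x y hx hy => by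
      rw [edist_dist]
      apply ENNReal.ofReal_le_ofReal
      have := (φd i x (fun h0 => hx (by simp [h0]))).1
      have := (φd i y (fun h0 => hy (by simp [h0]))).1
      have := dist_triangle_right x y i.1
      linarith)
    (fun x y => by
      rw [edist_dist, ← ENNReal.ofReal_add (l1_nonneg x) (l1_nonneg y), dist_eq_norm]
      apply ENNReal.ofReal_le_ofReal
      exact (norm_sub_le _ _).trans (add_le_add (norm_le_l1 x) (norm_le_l1 y)))
  refine ⟨π, p1, p2, p3.trans ?_⟩
  simp only [tr1]
  rw [tr2 _ (hνint n), tr2 μ hμint]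
  have e8 : 0 ≤ ε / 8 := by positivity
  calc _ ≤ ENNReal.ofReal (ε / 4) + ((ENNReal.ofReal (ε / 8) + ENNReal.ofReal (ε / 8)) +
        (ENNReal.ofReal (ε / 8) + ENNReal.ofReal (ε / 8))) := by
        refine add_le_add le_rfl (add_le_add (add_le_add ?_ h1) (add_le_add ?_ h2))
        · exact ENNReal.ofReal_le_ofReal h3.le
        · exact ENNReal.ofReal_le_ofReal tailμ.le
    _ ≤ ENNReal.ofReal ε := by
        rw [← ENNReal.ofReal_add e8 e8, ← ENNReal.ofReal_add (by positivity) (by positivity),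
          ← ENNReal.ofReal_add (by positivity) (by positivity)]
        apply ENNReal.ofReal_le_ofReal; linarith


lemma measurable_coord {d : ℕ} {T t : ℝ} (ht : t ∈ Icc (0:ℝ) T) :
    Measurable (fun ω : ↥(DReal d T) => (ω : ℝ → E d) t) := by
  rw [measurable_iff_comap_le]
  exact le_iSup (fun t : Set.Icc (0:ℝ) T =>
    MeasurableSpace.comap (fun ω : ↥(DReal d T) => (ω : ℝ → E d) t.1) inferInstance) ⟨t, ht⟩

lemma measurable_coord_can {d : ℕ} {T s t : ℝ} (ht : 0 ≤ t) (hts : t ≤ s) :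
    Measurable[canFilt d T s] (fun ω : ↥(DReal d T) => (ω : ℝ → E d) t) := by
  rw [measurable_iff_comap_le]
  exact le_iSup (fun u : {u : ℝ // 0 ≤ u ∧ u ≤ s} =>
    MeasurableSpace.comap (fun ω : ↥(DReal d T) => (ω : ℝ → E d) u.1) inferInstance) ⟨t, ht, hts⟩

lemma canFilt_le {d : ℕ} {T s : ℝ} (hs : s ≤ T) : canFilt d T s ≤ pathSigma d T := by
  refine iSup_le fun u => ?_
  rw [← measurable_iff_comap_le]
  exact measurable_coord ⟨u.2.1, u.2.2.trans hs⟩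

lemma canFilt_mono {d : ℕ} {T s t : ℝ} (hs : s ≤ t) : canFilt d T s ≤ canFilt d T t := by
  refine iSup_le fun u => ?_
  rw [← measurable_iff_comap_le]
  exact measurable_coord_can u.2.1 (u.2.2.trans hs)

lemma canFilt_zero {d : ℕ} {T : ℝ} : canFilt d T 0 = ⊥ := by
  rw [eq_bot_iff]
  refine iSup_le fun u => ?_
  have hu : u.1 = 0 := le_antisymm u.2.2 u.2.1
  have : (fun ω : ↥(DReal d T) => (ω : ℝ → E d) u.1) = fun _ => WithLp.toLp 2 (fun _ => (1:ℝ)) := by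
    funext ω
    rw [hu]
    ext i
    exact ω.2.2.2 i
  rw [this, MeasurableSpace.comap_const]

lemma measurable_to_can {d : ℕ} {T s : ℝ} {X : Type*} {m : MeasurableSpace X} {Φ : X → ↥(DReal d T)}
    (h : ∀ t, 0 ≤ t → t ≤ s → Measurable[m] fun x => (Φ x : ℝ → E d) t) :
    Measurable[m, canFilt d T s] Φ := by
  rw [measurable_iff_comap_le]
  unfold canFilt
  rw [MeasurableSpace.comap_iSup]
  refine iSup_le fun u => ?_
  rw [MeasurableSpace.comap_comp]
  exact (h u.1 u.2.1 u.2.2).comap_le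

lemma pathSigma_eq {d : ℕ} {T : ℝ} : pathSigma d T = canFilt d T T :=
  le_antisymm (iSup_le fun u => measurable_iff_comap_le.1 (measurable_coord_can u.2.1 u.2.2))
    (canFilt_le le_rfl)

lemma measurable_to_path {d : ℕ} {T : ℝ} {X : Type*} {m : MeasurableSpace X} {Φ : X → ↥(DReal d T)}
    (h : ∀ t, 0 ≤ t → t ≤ T → Measurable[m] fun x => (Φ x : ℝ → E d) t) :
    Measurable Φ := by
  have := measurable_to_can h
  rwa [← pathSigma_eq] at this

lemma setIntegral_coord {d : ℕ} {X : Type*} {m : MeasurableSpace X} {P : Measure X} {f : X → E d}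
    (hf : Integrable f P) (A : Set X) (i : Fin d) :
    ∫ x in A, f x i ∂P = (∫ x in A, f x ∂P) i :=
  ContinuousLinearMap.integral_comp_comm (EuclideanSpace.proj i : E d →L[ℝ] ℝ) hf.integrableOn

lemma integrable_coord {d : ℕ} {X : Type*} {m : MeasurableSpace X} {P : Measure X} {f : X → E d}
    (hf : Integrable f P) (i : Fin d) : Integrable (fun x => f x i) P :=
  ContinuousLinearMap.integrable_comp (EuclideanSpace.proj i : E d →L[ℝ] ℝ) hf

lemma martMeasure_of_mart {d : ℕ} {T : ℝ} (hT : 0 < T) {X : Type*} {mX : MeasurableSpace X}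
    (P : Measure X) [IsProbabilityMeasure P] (ℱ : Filtration ℕ mX) (M : ℕ → X → E d)
    (hM : Martingale M ℱ P) (n : ℕ) (h0 : ∀ x i, M 0 x i = 1) (Φ : X → ↥(DReal d T))
    (hΦ : ∀ x, (Φ x : ℝ → E d) = stepPath (T / (n + 1)) n (fun j => M j x)) :
    Measurable Φ ∧ IsMartingaleMeasure d T (P.map Φ) := by
  have hh : 0 < T / (n + 1) := by positivity
  have hmono : ∀ s t : ℝ, s ≤ t → min ⌊s / (T / (n + 1))⌋₊ n ≤ min ⌊t / (T / (n + 1))⌋₊ n := by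
    intro s t hst
    exact min_le_min_right _ (Nat.floor_mono (by gcongr))
  have hco : ∀ t, (fun x => (Φ x : ℝ → E d) t) = M (min ⌊t / (T / (n + 1))⌋₊ n) := by
    intro t; funext x; rw [hΦ]; rfl
  have hΦm : Measurable Φ := by
    refine measurable_to_path fun t _ _ => ?_
    rw [hco]
    exact ((hM.1 _).mono (ℱ.le _)).measurable
  have hΦc : ∀ s, Measurable[ℱ (min ⌊s / (T / (n + 1))⌋₊ n), canFilt d T s] Φ := by
    intro s
    refine measurable_to_can fun t _ hts => ?_
    rw [hco]
    exact ((hM.1 _).mono (ℱ.mono (hmono _ _ hts))).measurable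
  have hint : ∀ t ∈ Set.Icc (0:ℝ) T,
      Integrable (fun ω : ↥(DReal d T) => (ω : ℝ → E d) t) (P.map Φ) := by
    intro t ht
    rw [integrable_map_measure (measurable_coord ht).aestronglyMeasurable hΦm.aemeasurable]
    change Integrable (fun x => (Φ x : ℝ → E d) t) P
    rw [hco]
    exact hM.integrable _
  have : IsProbabilityMeasure (P.map Φ) := Measure.isProbabilityMeasure_map hΦm.aemeasurable
  refine ⟨hΦm, this, hint, ?_⟩
  intro s t hs hst ht i
  have hms : s ∈ Icc (0:ℝ) T := ⟨hs, hst.trans ht⟩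
  have hmt : t ∈ Icc (0:ℝ) T := ⟨hs.trans hst, ht⟩
  refine ae_eq_condExp_of_forall_setIntegral_eq (canFilt_le (hst.trans ht))
    (integrable_coord (hint t hmt) i) (fun A _ _ => (integrable_coord (hint s hms) i).integrableOn)
    ?_ ?_
  · intro A hA _
    have hA' := canFilt_le (hst.trans ht) A hA
    rw [setIntegral_coord (hint s hms), setIntegral_coord (hint t hmt),
      setIntegral_map hA' (measurable_coord hms).aestronglyMeasurable hΦm.aemeasurable,
      setIntegral_map hA' (measurable_coord hmt).aestronglyMeasurable hΦm.aemeasurable]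
    have e := hM.setIntegral_eq (hmono s t hst) (hΦc s hA)
    rw [← hco, ← hco] at e
    rw [e]
  · have : Measurable[canFilt d T s] (fun ω : ↥(DReal d T) => (ω : ℝ → E d) s i) :=
      Measurable.comp (g := fun y : E d => y i) (by fun_prop) (measurable_coord_can hs le_rfl)
    exact this.aestronglyMeasurable


lemma exists_glue {X Y Z : Type*} [MeasurableSpace X] [MeasurableSpace Y] [MeasurableSpace Z]
    [StandardBorelSpace Z] [Nonempty Z] (Q : Measure X) [IsProbabilityMeasure Q] {f : X → Y}
    (hf : Measurable f) (π : Measure (Y × Z)) [IsFiniteMeasure π] (h : Q.map f = π.map Prod.fst) :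
    ∃ P : Measure (X × Z), P.map Prod.fst = Q ∧ P.map (fun p => (f p.1, p.2)) = π := by
  refine ⟨Q ⊗ₘ (π.condKernel.comap f hf), ?_, ?_⟩
  · exact Measure.fst_compProd _ _
  · ext s hs
    have hm : Measurable (fun p : X × Z => (f p.1, p.2)) := by fun_prop
    conv_rhs => rw [← π.disintegrate π.condKernel]
    rw [Measure.map_apply hm hs, Measure.compProd_apply (hm hs), Measure.compProd_apply hs,
      Measure.fst, ← h, lintegral_map (ProbabilityTheory.Kernel.measurable_kernel_prodMk_left hs) hf]
    rfl

lemma tau_mem {T : ℝ} (hT : 0 < T) (n j : ℕ) : tau T n j ∈ Icc (0:ℝ) T := by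
  unfold tau
  split_ifs with h
  · refine ⟨by positivity, ?_⟩
    have : (j:ℝ) ≤ n + 1 := by
      have : (j:ℝ) < n := by exact_mod_cast h
      linarith
    rw [div_mul_eq_mul_div, div_le_iff₀ (by positivity)]
    gcongr
  · exact ⟨hT.le, le_rfl⟩

lemma tau_mono {T : ℝ} (hT : 0 < T) (n : ℕ) : Monotone (tau T n) := by
  intro i j hij
  by_cases h : j < n
  · unfold tau
    rw [if_pos h, if_pos (hij.trans_lt h)]
    gcongr
  · have : tau T n j = T := by unfold tau; rw [if_neg h]
    rw [this]; exact (tau_mem hT n i).2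

def discPath {d : ℕ} {T : ℝ} (hT : 0 < T) (n : ℕ) (ω : ↥(DReal d T)) : ↥(DReal d T) :=
  ⟨stepPath (T / ((n + 1 : ℕ) + 1)) (n + 1) (fun j => (ω : ℝ → E d) (tau T (n + 1) j)),
    stepPath_mem hT _ _ (fun i => by
      have : tau T (n + 1) 0 = 0 := by simp [tau]
      rw [this]; exact ω.2.2.2 i)⟩

lemma measurable_discPath {d : ℕ} {T : ℝ} (hT : 0 < T) (n : ℕ) :
    Measurable (discPath (d := d) hT n) := by
  refine measurable_to_path fun t _ _ => ?_
  exact measurable_coord (tau_mem hT _ _)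

/-- the filtration on the extended space -/
def glueFilt (d : ℕ) {T : ℝ} (hT : 0 < T) (n : ℕ) :
    Filtration ℕ (inferInstance : MeasurableSpace (↥(DReal d T) × E d)) where
  seq j := if j < n then (canFilt d T (tau T n j)).comap Prod.fst else inferInstance
  mono' := by
    intro i j hij
    by_cases h : j < n
    · simp only [if_pos h, if_pos (hij.trans_lt h)]
      exact MeasurableSpace.comap_mono (canFilt_mono (tau_mono hT n hij))
    · by_cases h' : i < n
      · simp only [if_neg h, if_pos h']
        exact (MeasurableSpace.comap_mono (canFilt_le (tau_mem hT n i).2)).trans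
          measurable_fst.comap_le
      · simp only [if_neg h, if_neg h']
        exact le_rfl
  le' := by
    intro i
    by_cases h' : i < n
    · simp only [if_pos h']
      exact (MeasurableSpace.comap_mono (canFilt_le (tau_mem hT n i).2)).trans
          measurable_fst.comap_le
    · simp only [if_neg h']
      exact le_rfl

lemma glueFilt_lt {d : ℕ} {T : ℝ} (hT : 0 < T) {n j : ℕ} (h : j < n) :
    glueFilt d hT n j = (canFilt d T (tau T n j)).comap Prod.fst := if_pos h

lemma glueFilt_ge {d : ℕ} {T : ℝ} (hT : 0 < T) {n j : ℕ} (h : n ≤ j) :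
    glueFilt d hT n j = (inferInstance : MeasurableSpace (↥(DReal d T) × E d)) := if_neg (by omega)

lemma glueFilt_zero {d : ℕ} {T : ℝ} (hT : 0 < T) {n : ℕ} :
    glueFilt d hT (n + 1) 0 = ⊥ := by
  rw [glueFilt_lt hT (by omega)]
  have : tau T (n + 1) 0 = 0 := by simp [tau]
  rw [this, canFilt_zero, MeasurableSpace.comap_bot]

lemma glue_condExp {d : ℕ} {T : ℝ} (hT : 0 < T) {n : ℕ} (Q : Measure ↥(DReal d T))
    (hQ : IsMartingaleMeasure d T Q) (P : Measure (↥(DReal d T) × E d)) [IsProbabilityMeasure P]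
    (hP : P.map Prod.fst = Q) (j : ℕ) :
    (fun p => (p.1 : ℝ → E d) (tau T n j)) =ᵐ[P]
      P[fun p => (p.1 : ℝ → E d) T | glueFilt d hT n j] := by
  have hTT : T ∈ Icc (0:ℝ) T := ⟨hT.le, le_rfl⟩
  have hint : ∀ t ∈ Icc (0:ℝ) T,
      Integrable (fun p : ↥(DReal d T) × E d => (p.1 : ℝ → E d) t) P := by
    intro t ht
    have := hQ.2.1 t ht
    rw [← hP, integrable_map_measure (measurable_coord ht).aestronglyMeasurable
      measurable_fst.aemeasurable] at this
    exact this
  by_cases h : j < n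
  · rw [glueFilt_lt hT h]
    have hle : (canFilt d T (tau T n j)).comap (Prod.fst : ↥(DReal d T) × E d → _) ≤ Prod.instMeasurableSpace :=
      (MeasurableSpace.comap_mono (canFilt_le (tau_mem hT n j).2)).trans measurable_fst.comap_le
    refine ae_eq_condExp_of_forall_setIntegral_eq hle (hint T hTT)
      (fun A _ _ => (hint _ (tau_mem hT n j)).integrableOn) ?_ ?_
    · rintro A ⟨B, hB, rfl⟩ _
      have hB' := canFilt_le (tau_mem hT n j).2 B hB
      have : IsProbabilityMeasure Q := hQ.1
      have key : ∫ ω in B, (ω : ℝ → E d) (tau T n j) ∂Q = ∫ ω in B, (ω : ℝ → E d) T ∂Q := by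
        ext i
        rw [← setIntegral_coord (hQ.2.1 _ (tau_mem hT n j)), ← setIntegral_coord (hQ.2.1 _ hTT)]
        have e := hQ.2.2 (tau T n j) T (tau_mem hT n j).1 (tau_mem hT n j).2 le_rfl i
        rw [← setIntegral_condExp (canFilt_le (tau_mem hT n j).2)
          (integrable_coord (hQ.2.1 _ hTT) i) hB]
        exact integral_congr_ae (ae_restrict_of_ae e)
      rw [← hP, setIntegral_map hB' (measurable_coord (tau_mem hT n j)).aestronglyMeasurable
          measurable_fst.aemeasurable,
        setIntegral_map hB' (measurable_coord hTT).aestronglyMeasurable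
          measurable_fst.aemeasurable] at key
      exact key
    · have : Measurable[(canFilt d T (tau T n j)).comap Prod.fst]
          (fun p : ↥(DReal d T) × E d => (p.1 : ℝ → E d) (tau T n j)) :=
        (measurable_coord_can (tau_mem hT n j).1 le_rfl).comp (comap_measurable _)
      exact this.aestronglyMeasurable
  · rw [glueFilt_ge hT (not_lt.1 h)]
    have : tau T n j = T := by unfold tau; rw [if_neg h]
    have hs : StronglyMeasurable (fun p : ↥(DReal d T) × E d => (p.1 : ℝ → E d) T) :=
      ((measurable_coord hTT).comp measurable_fst).stronglyMeasurable
    rw [this]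
    exact (condExp_of_stronglyMeasurable le_rfl hs (hint T hTT)).symm.eventuallyEq


lemma doob_norm {d : ℕ} {X : Type*} {mX : MeasurableSpace X} (P : Measure X) [IsProbabilityMeasure P]
    (ℱ : Filtration ℕ mX) (Z : X → E d) (hZ : Integrable Z P) (n : ℕ) {δ : ℝ} (hδ : 0 < δ) :
    ∃ B : Set X, MeasurableSet B ∧ P.real B ≤ (∫ x, ‖Z x‖ ∂P) / δ ∧
      ∀ᵐ x ∂P, x ∉ B → ∀ j ≤ n, ‖(P[Z | ℱ j]) x‖ ≤ δ := by
  set Y : ℕ → X → ℝ := fun j => P[fun x => ‖Z x‖ | ℱ j] with hY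
  have hsub := (martingale_condExp (fun x => ‖Z x‖) ℱ P).submartingale.pos
  have hmax := maximal_ineq hsub (fun j x => by simp) (ε := ⟨δ, hδ.le⟩) n
  set B0 := {ω | (((⟨δ, hδ.le⟩ : NNReal) : NNReal) : ℝ) ≤ (Finset.range (n + 1)).sup' Finset.nonempty_range_add_one
    fun k => (fun j => P[fun x => ‖Z x‖ | ℱ j])⁺ k ω} with hB0
  refine ⟨toMeasurable P B0, measurableSet_toMeasurable _ _, ?_, ?_⟩
  · have hpos : 0 ≤ᵐ[P] Y n := condExp_nonneg (Eventually.of_forall fun x => norm_nonneg _)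
    have h1 : ∫ x in B0, ((fun j => P[fun x => ‖Z x‖ | ℱ j])⁺ n) x ∂P ≤ ∫ x, ‖Z x‖ ∂P := by
      calc _ ≤ ∫ x, ((fun j => P[fun x => ‖Z x‖ | ℱ j])⁺ n) x ∂P :=
            setIntegral_le_integral (hsub.integrable n) (Eventually.of_forall fun x => by simp)
        _ = ∫ x, Y n x ∂P := by
            refine integral_congr_ae ?_
            filter_upwards [hpos] with x hx
            have hx' : 0 ≤ Y n x := hx
            simp only [Pi.posPart_apply]
            exact posPart_eq_self.2 hx'
        _ = _ := integral_condExp (ℱ.le n)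
    have h2 := hmax.trans (ENNReal.ofReal_le_ofReal h1)
    rw [le_div_iff₀ hδ, Measure.real, measure_toMeasurable]
    have h3 := ENNReal.toReal_mono (by simp) h2
    rw [ENNReal.toReal_mul, ENNReal.toReal_ofReal (integral_nonneg fun x => norm_nonneg _)] at h3
    rw [mul_comm]
    exact h3
  · have hall : ∀ᵐ x ∂P, ∀ j, ‖(P[Z | ℱ j]) x‖ ≤ Y j x :=
      ae_all_iff.2 fun j => norm_condExp_le Z
    filter_upwards [hall] with x hx hxB j hj
    have : x ∉ B0 := fun h => hxB (subset_toMeasurable _ _ h)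
    simp only [hB0, mem_ofPred_eq, not_le, Finset.sup'_lt_iff] at this
    have h2 := this j (Finset.mem_range.2 (by omega))
    refine (hx j).trans (le_trans ?_ h2.le)
    simp only [Pi.posPart_apply]
    exact le_posPart _

lemma transfer_disc {d : ℕ} {T : ℝ} (hT : 0 < T) (G : ↥(DReal d T) → ℝ) {C : ℝ}
    (hC : ∀ ω, |G ω| ≤ C) (hG : Measurable G) (mG : ℝ → ℝ)
    (hGu : ∀ ω ωt : ↥(DReal d T),
      |G ω - G ωt| ≤ mG (skorokhodDist d T (ω : ℝ → E d) (ωt : ℝ → E d)))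
    {δ e c : ℝ} (hδ : 0 < δ) (he : ∀ r, 0 ≤ r → r ≤ δ → mG r ≤ e) (hc : 0 ≤ c)
    (Q : Measure ↥(DReal d T)) (hQ : IsMartingaleMeasure d T Q)
    (π : Measure (E d × E d)) (ν2 : Measure (E d)) [IsProbabilityMeasure ν2]
    (h1 : π.map Prod.fst = Q.map (fun ω : ↥(DReal d T) => (ω : ℝ → E d) T))
    (h2 : π.map Prod.snd = ν2) (hint2 : Integrable (id : E d → E d) ν2)
    (hbary : ∀ k : Fin d, ∫ x, x k ∂ν2 = 1)
    (hcost : ∫⁻ p, edist p.1 p.2 ∂π ≤ ENNReal.ofReal c) (n : ℕ) :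
    ∃ Q' : Measure ↥(DReal d T), IsMartingaleMeasure d T Q' ∧
      Q'.map (fun ω : ↥(DReal d T) => (ω : ℝ → E d) T) = ν2 ∧
      ∫ ω, G (discPath hT n ω) ∂Q ≤ ∫ ω, G ω ∂Q' + e + 2 * C * (c / δ) := by
  have hQp : IsProbabilityMeasure Q := hQ.1
  have hTT : T ∈ Icc (0:ℝ) T := ⟨hT.le, le_rfl⟩
  have hπ : IsProbabilityMeasure π := by
    have : IsProbabilityMeasure (π.map Prod.snd) := by rw [h2]; infer_instance
    exact Measure.isProbabilityMeasure_of_map Prod.snd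
  obtain ⟨P, hP1, hP2⟩ := exists_glue Q (measurable_coord (d := d) hTT) π h1.symm
  have hPp : IsProbabilityMeasure P := by
    have : IsProbabilityMeasure (P.map Prod.fst) := by rw [hP1]; infer_instance
    exact Measure.isProbabilityMeasure_of_map Prod.fst
  set ST : ↥(DReal d T) × E d → E d := fun p => (p.1 : ℝ → E d) T with hST
  set Λ : ↥(DReal d T) × E d → E d := Prod.snd with hΛ
  have hSTm : Measurable ST := (measurable_coord hTT).comp measurable_fst
  have hmm : Measurable (fun p : ↥(DReal d T) × E d => (ST p, p.2)) := hSTm.prodMk measurable_snd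
  have hΛlaw : P.map Λ = ν2 := by
    rw [← h2, ← hP2, Measure.map_map measurable_snd hmm]; rfl
  have hΛint : Integrable Λ P := by
    rw [← hΛlaw, integrable_map_measure (by fun_prop) (by fun_prop)] at hint2
    exact hint2
  have hSTint : Integrable ST P := by
    have := hQ.2.1 T hTT
    rw [← hP1, integrable_map_measure (measurable_coord hTT).aestronglyMeasurable
      measurable_fst.aemeasurable] at this
    exact this
  have hZcost : ∫ p, ‖(Λ - ST) p‖ ∂P ≤ c := by
    have : ∫⁻ p, edist (ST p) (Λ p) ∂P ≤ ENNReal.ofReal c := by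
      rw [← hP2, lintegral_map (by fun_prop) hmm] at hcost
      exact hcost
    rw [integral_norm_eq_lintegral_enorm (hΛint.sub hSTint).1]
    refine ENNReal.toReal_le_of_le_ofReal hc (le_trans (le_of_eq ?_) this)
    refine lintegral_congr fun p => ?_
    rw [edist_comm, edist_eq_enorm_sub]; rfl
  set ℱ := glueFilt d hT (n + 1) with hℱ
  set M : ℕ → ↥(DReal d T) × E d → E d := fun j => P[Λ | ℱ j] with hM
  have hmart : Martingale M ℱ P := martingale_condExp Λ ℱ P
  have hM0 : ∀ x i, M 0 x i = 1 := by
    intro x i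
    have : M 0 = fun _ => ∫ p, Λ p ∂P := by
      rw [hM]; simp only [hℱ, glueFilt_zero hT]; exact condExp_bot _
    rw [this]
    have hb := hbary i
    rw [← hΛlaw, integral_map (by fun_prop) (by fun_prop)] at hb
    rw [← hb]
    have := setIntegral_coord hΛint univ i
    simp only [Measure.restrict_univ] at this
    exact this.symm
  have hMn : M (n + 1) = Λ := by
    rw [hM]; simp only [hℱ, glueFilt_ge hT le_rfl]
    exact condExp_of_stronglyMeasurable le_rfl measurable_snd.stronglyMeasurable hΛint
  let Φ : ↥(DReal d T) × E d → ↥(DReal d T) := fun p =>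
    ⟨stepPath (T / ((n + 1 : ℕ) + 1)) (n + 1) (fun j => M j p), stepPath_mem hT _ _ (hM0 p)⟩
  obtain ⟨hΦm, hΦ⟩ := martMeasure_of_mart hT P ℱ M hmart (n + 1) hM0 Φ (fun _ => rfl)
  refine ⟨P.map Φ, hΦ, ?_, ?_⟩
  · rw [Measure.map_map (measurable_coord hTT) hΦm, ← hΛlaw, ← hMn]
    congr 1
    funext p
    exact stepPath_T hT (n + 1) (fun j => M j p) (hn_lt hT _).le
  obtain ⟨B, hB, hPB, hoff⟩ := doob_norm P ℱ (Λ - ST) (hΛint.sub hSTint) (n + 1) hδ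
  have hall : ∀ᵐ p ∂P, ∀ j, (P[Λ - ST | ℱ j]) p = M j p - (p.1 : ℝ → E d) (tau T (n + 1) j) := by
    refine ae_all_iff.2 fun j => ?_
    filter_upwards [condExp_sub hΛint hSTint (ℱ j), glue_condExp hT (n := n + 1) Q hQ P hP1 j]
      with p hp1 hp2
    rw [hp1, hp2]; rfl
  have hbound : ∀ᵐ p ∂P, G (discPath hT n p.1) ≤ G (Φ p) + e + B.indicator (fun _ => 2 * C) p := by
    filter_upwards [hall, hoff] with p hp1 hp2
    by_cases hpB : p ∈ B
    · have a1 := abs_le.1 (hC (discPath hT n p.1))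
      have a2 := abs_le.1 (hC (Φ p))
      have e0 : 0 ≤ e := by
        have := he 0 le_rfl hδ.le
        have h3 := hGu (Φ p) (Φ p)
        have h4 : skorokhodDist d T (Φ p : ℝ → E d) (Φ p : ℝ → E d) ≤ 0 := 
          skor_step_le hT (n + 1) _ _ (by simp)
        have h5 := skor_nonneg hT (Φ p : ℝ → E d) (Φ p : ℝ → E d)
        have h6 := he _ h5 (h4.trans hδ.le)
        exact (abs_nonneg _).trans (h3.trans h6)
      rw [indicator_of_mem hpB]
      linarith
    · rw [indicator_of_notMem hpB]
      have hd : skorokhodDist d T (discPath hT n p.1 : ℝ → E d) (Φ p : ℝ → E d) ≤ δ := by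
        refine skor_step_le hT (n + 1) _ _ fun j hj => ?_
        have := hp2 hpB j hj
        rw [hp1 j] at this
        rw [norm_sub_rev]; exact this
      have := (hGu (discPath hT n p.1) (Φ p)).trans (he _ (skor_nonneg hT _ _) hd)
      have := (abs_le.1 this).2
      linarith
  have hbi : ∀ {X : Type} {mX : MeasurableSpace X} (R : Measure X) [IsProbabilityMeasure R]
      (g : X → ↥(DReal d T)), Measurable g → Integrable (fun x => G (g x)) R := by
    intro X mX R _ g hg
    exact Integrable.of_bound (hG.comp hg).aestronglyMeasurable C
      (Eventually.of_forall fun x => hC _)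
  have i1 : ∫ ω, G (discPath hT n ω) ∂Q = ∫ p, G (discPath hT n p.1) ∂P := by
    rw [← hP1]
    exact integral_map measurable_fst.aemeasurable
      (hG.comp (measurable_discPath hT n)).aestronglyMeasurable
  have i2 : ∫ ω, G ω ∂(P.map Φ) = ∫ p, G (Φ p) ∂P :=
    integral_map hΦm.aemeasurable hG.aestronglyMeasurable
  have C0 : 0 ≤ C := by
    have : Nonempty ↥(DReal d T) := nonempty_of_isProbabilityMeasure Q
    exact (abs_nonneg _).trans (hC this.some)
  rw [i1, i2]
  have iΦ := hbi P Φ hΦm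
  have iB : Integrable (B.indicator (fun _ => 2 * C)) P := (integrable_const _).indicator hB
  calc ∫ p, G (discPath hT n p.1) ∂P
      ≤ ∫ p, (G (Φ p) + e + B.indicator (fun _ => 2 * C) p) ∂P :=
        integral_mono_ae (hbi P _ ((measurable_discPath hT n).comp measurable_fst))
          ((iΦ.add (integrable_const e)).add iB) hbound
    _ = ∫ p, G (Φ p) ∂P + e + P.real B * (2 * C) := by
        have iΦe : Integrable (fun p => G (Φ p) + e) P := iΦ.add (integrable_const e)
        rw [integral_add iΦe iB, integral_add iΦ (integrable_const e),
          integral_indicator_const _ hB]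
        simp
    _ ≤ _ := by
        have : P.real B ≤ c / δ := hPB.trans (by gcongr)
        nlinarith


lemma vfun_le {d : ℕ} {T : ℝ} (hT : 0 < T) (G : ↥(DReal d T) → ℝ) {C : ℝ}
    (hC : ∀ ω, |G ω| ≤ C) (hG : Measurable G) (mG : ℝ → ℝ) (hmGnonneg : ∀ r, 0 ≤ mG r)
    (hmG0 : mG 0 = 0) (hmGcont : ContinuousAt mG 0)
    (hGu : ∀ ω ωt : ↥(DReal d T),
      |G ω - G ωt| ≤ mG (skorokhodDist d T (ω : ℝ → E d) (ωt : ℝ → E d)))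
    {ε : ℝ} (hε : 0 < ε) :
    ∃ c : ℝ, 0 < c ∧ ∀ (ν1 ν2 : Measure (E d)) (π : Measure (E d × E d)),
      IsProbabilityMeasure ν2 → Integrable (id : E d → E d) ν2 →
      (∀ k : Fin d, ∫ x, x k ∂ν2 = 1) → π.map Prod.fst = ν1 → π.map Prod.snd = ν2 →
      ∫⁻ p, edist p.1 p.2 ∂π ≤ ENNReal.ofReal c →
      vfun d T G ν1 ≤ vfun d T G ν2 + (ε : EReal) := by
  obtain ⟨δ, hδ, hδm⟩ : ∃ δ > 0, ∀ r, 0 ≤ r → r ≤ δ → mG r ≤ ε / 3 := by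
    have := Metric.continuousAt_iff.1 hmGcont (ε / 3) (by positivity)
    obtain ⟨δ, hδ, h⟩ := this
    refine ⟨δ / 2, by positivity, fun r h0 h1 => ?_⟩
    have := h (x := r) (by rw [Real.dist_eq, sub_zero, abs_of_nonneg h0]; linarith)
    rw [hmG0, Real.dist_eq, sub_zero] at this
    exact (le_abs_self _).trans this.le
  refine ⟨ε * δ / (6 * (|C| + 1)), by positivity, ?_⟩
  intro ν1 ν2 π hp hint hb h1 h2 hcost
  refine sSup_le ?_
  rintro _ ⟨Q, hQ, hQν, rfl⟩
  have hQp := hQ.1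
  -- discretisation
  have hlim : Tendsto (fun n : ℕ => ∫ ω, G (discPath hT n ω) ∂Q) atTop (nhds (∫ ω, G ω ∂Q)) := by
    refine tendsto_integral_of_dominated_convergence (fun _ => C)
      (fun n => (hG.comp (measurable_discPath hT n)).aestronglyMeasurable) (integrable_const _)
      (fun n => Eventually.of_forall fun ω => hC _) (Eventually.of_forall fun ω => ?_)
    have hs := (skor_approx hT ω.2).comp (tendsto_add_atTop_nat 1)
    have hs2 : Tendsto mG (nhds 0) (nhds 0) := by
      have : Tendsto mG (nhds 0) (nhds (mG 0)) := hmGcont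
      rwa [hmG0] at this
    have hs3 := hs2.comp hs
    rw [tendsto_iff_dist_tendsto_zero]
    refine squeeze_zero (fun _ => dist_nonneg) (fun n => ?_) hs3
    rw [dist_comm, Real.dist_eq]
    exact hGu ω (discPath hT n ω)
  obtain ⟨n, hn⟩ := (hlim.eventually (lt_mem_nhds (sub_lt_self _ (show 0 < ε / 3 by positivity)))).exists
  obtain ⟨Q', hQ', hQ'ν, hle⟩ := transfer_disc hT G hC hG mG hGu hδ hδm (by positivity) Q hQ π ν2
    (h1.trans hQν.symm) h2 hint hb hcost n
  have hfin : 2 * C * (ε * δ / (6 * (|C| + 1)) / δ) ≤ ε / 3 := by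
    have e1 : ε * δ / (6 * (|C| + 1)) / δ = ε / (6 * (|C| + 1)) := by field_simp
    rw [e1, ← mul_div_assoc, div_le_iff₀ (by positivity)]
    nlinarith [le_abs_self C]
  have hmain : ∫ ω, G ω ∂Q ≤ ∫ ω, G ω ∂Q' + ε := by linarith
  calc ((∫ ω, G ω ∂Q : ℝ) : EReal) ≤ ((∫ ω, G ω ∂Q' + ε : ℝ) : EReal) := by exact_mod_cast hmain
    _ = ((∫ ω, G ω ∂Q' : ℝ) : EReal) + (ε : EReal) := EReal.coe_add _ _
    _ ≤ _ := by
      gcongr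
      exact le_sSup ⟨Q', hQ', hQ'ν, rfl⟩

lemma vfun_le_C {d : ℕ} {T : ℝ} (G : ↥(DReal d T) → ℝ) {C : ℝ}
    (hC : ∀ ω, |G ω| ≤ C) (ν : Measure (E d)) : vfun d T G ν ≤ (C : EReal) := by
  refine sSup_le ?_
  rintro _ ⟨Q, hQ, hQν, rfl⟩
  have hQp := hQ.1
  have := norm_integral_le_of_norm_le_const (μ := Q) (f := G) (C := C)
    (Eventually.of_forall fun ω => hC ω)
  simp only [probReal_univ, mul_one] at this
  exact_mod_cast (le_abs_self _).trans this

lemma tendsto_ereal {u : ℕ → EReal} {a : EReal} (ha : a ≠ ⊤)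
    (h1 : ∀ ε : ℝ, 0 < ε → ∀ᶠ n in atTop, u n ≤ a + (ε : EReal))
    (h2 : ∀ ε : ℝ, 0 < ε → ∀ᶠ n in atTop, a ≤ u n + (ε : EReal)) :
    Tendsto u atTop (nhds a) := by
  induction a with
  | top => exact absurd rfl ha
  | bot =>
    refine tendsto_nhds_of_eventually_eq ?_
    filter_upwards [h1 1 one_pos] with n hn
    simpa using hn
  | coe x =>
    rw [tendsto_order]
    constructor
    · intro b hb
      induction b with
      | top => simp at hb
      | bot =>
        filter_upwards [h2 1 one_pos] with n hn
        rw [bot_lt_iff_ne_bot]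
        intro h
        rw [h] at hn
        simp at hn
      | coe y =>
        have hy : y < x := by exact_mod_cast hb
        filter_upwards [h2 ((x - y) / 2) (by linarith)] with n hn
        generalize u n = w at hn ⊢
        induction w with
        | top => simp
        | bot => simp at hn
        | coe z =>
          have : x ≤ z + (x - y) / 2 := by exact_mod_cast hn
          exact_mod_cast (by linarith : y < z)
    · intro b hb
      induction b with
      | bot => simp at hb
      | top =>
        filter_upwards [h1 1 one_pos] with n hn
        refine hn.trans_lt ?_
        rw [← EReal.coe_add]; exact EReal.coe_lt_top _
      | coe y =>
        have hy : x < y := by exact_mod_cast hb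
        filter_upwards [h1 ((y - x) / 2) (by linarith)] with n hn
        refine hn.trans_lt ?_
        rw [← EReal.coe_add]
        exact_mod_cast (by linarith : x + (y - x) / 2 < y)

/-- continuity of the dual value in the marginal: if `G` is bounded,
measurable and uniformly continuous for the Skorokhod distance, `ν_n` are probability
measures on `ℝ^d` with barycenter `(1,…,1)` converging weakly to a probability measure `μ`
supported on `(0,∞)^d` with barycenter `(1,…,1)`, and the negative parts of each coordinate
vanish in the limit, then `v(ν_n) → v(μ)`. -/
theorem statement0 (d : ℕ) (hd : 1 ≤ d) (T : ℝ) (hT : 0 < T)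
    (G : ↥(DReal d T) → ℝ)
    (hGbdd : ∃ C : ℝ, ∀ ω, |G ω| ≤ C)
    (hGmeas : Measurable G)
    (mG : ℝ → ℝ) (hmGnonneg : ∀ r, 0 ≤ mG r) (hmG0 : mG 0 = 0) (hmGcont : ContinuousAt mG 0)
    (hGucont : ∀ ω ωt : ↥(DReal d T),
      |G ω - G ωt| ≤ mG (skorokhodDist d T (ω : ℝ → E d) (ωt : ℝ → E d)))
    (ν : ℕ → Measure (E d)) (hνprob : ∀ n, IsProbabilityMeasure (ν n))
    (hνint : ∀ n, Integrable (id : E d → E d) (ν n))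
    (hνbary : ∀ n, ∀ k : Fin d, ∫ x, x k ∂(ν n) = 1)
    (μ : Measure (E d)) (hμprob : IsProbabilityMeasure μ)
    (hμsupp : μ ({x : E d | ∀ i, 0 < x i}ᶜ) = 0)
    (hμint : Integrable (id : E d → E d) μ)
    (hμbary : ∀ k : Fin d, ∫ x, x k ∂μ = 1)
    (hweak : ∀ f : BoundedContinuousFunction (E d) ℝ,
      Tendsto (fun n => ∫ x, f x ∂(ν n)) atTop (nhds (∫ x, f x ∂μ)))
    (hneg : ∀ k : Fin d,
      Tendsto (fun n => ∫ x, max (-(x k)) 0 ∂(ν n)) atTop (nhds 0)) :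
    Tendsto (fun n => vfun d T G (ν n)) atTop (nhds (vfun d T G μ)) := by
  obtain ⟨C, hC⟩ := hGbdd
  have htop : vfun d T G μ ≠ ⊤ := ((vfun_le_C G hC μ).trans_lt (EReal.coe_lt_top _)).ne
  refine tendsto_ereal htop ?_ ?_
  · intro ε hε
    obtain ⟨c, hc, h⟩ := vfun_le hT G hC hGmeas mG hmGnonneg hmG0 hmGcont hGucont hε
    filter_upwards [exists_coupling_small ν hνprob hνint hνbary μ hμprob hμsupp hμint hμbary
      hweak hneg hc] with n hn
    obtain ⟨π, h1, h2, h3⟩ := hn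
    exact h (ν n) μ π hμprob hμint hμbary h1 h2 h3
  · intro ε hε
    obtain ⟨c, hc, h⟩ := vfun_le hT G hC hGmeas mG hmGnonneg hmG0 hmGcont hGucont hε
    filter_upwards [exists_coupling_small ν hνprob hνint hνbary μ hμprob hμsupp hμint hμbary
      hweak hneg hc] with n hn
    obtain ⟨π, h1, h2, h3⟩ := hn
    refine h μ (ν n) (π.map Prod.swap) (hνprob n) (hνint n) (hνbary n) ?_ ?_ ?_
    · rw [Measure.map_map measurable_fst measurable_swap, ← h2]; rfl
    · rw [Measure.map_map measurable_snd measurable_swap, ← h1]; rfl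
    · rw [lintegral_map (by fun_prop) measurable_swap]
      refine le_trans (le_of_eq ?_) h3
      exact lintegral_congr fun p => edist_comm _ _

end
end

section
/- Let n, M ∈ ℕ with √d·2^{-n} < T, and let 0 = τ_0 < τ_1 < ⋯ < τ_M = T be real numbers with τ_{k+1} − τ_k ≤ √d·2^{-n} for every k = 0,…,M−1. Define τ̂_0 := 0, τ̂_1 := √d·2^{-n}, τ̂_{M+1} := T, and recursively for k = 2,…,M: τ̂_k := τ̂_{k−1} + (1 − √d·2^{-n}/T)·sup{Δt ∈ B^{(n+k)} : Δt < τ_{k−1} − τ_{k−2}}. Then (i) 0 = τ̂_0 < √d·2^{-n} = τ̂_1 < τ̂_2 < ⋯ < τ̂_M < τ̂_{M+1} = T, and (ii) |τ̂_k − τ_k| ≤ √d·2^{-n+1} for every k = 0,…,M. -/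
open Filter Set
open scoped Classical

noncomputable section

/-- The dyadic grid set `B^{(i)} = {k·√d·2^{-i} : k ≥ 1} ∪ {√d·2^{-i}/k : k ≥ 1}`. -/
def Bset (d i : ℕ) : Set ℝ :=
  {x | ∃ k : ℕ, 0 < k ∧ x = (k : ℝ) * (Real.sqrt d * 2 ^ (-(i : ℤ)))} ∪
  {x | ∃ k : ℕ, 0 < k ∧ x = Real.sqrt d * 2 ^ (-(i : ℤ)) / (k : ℝ)}

/-- The deterministic grid times `τ̂_k`: `τ̂_0 = 0`, `τ̂_1 = √d·2^{-n}`,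
`τ̂_k = τ̂_{k−1} + (1 − √d·2^{-n}/T)·sup{Δt ∈ B^{(n+k)} : Δt < τ_{k−1} − τ_{k−2}}` for
`2 ≤ k ≤ M`, and `τ̂_{M+1} = T`. -/
def gridTimes (d n : ℕ) (T : ℝ) (τ : ℕ → ℝ) (M : ℕ) : ℕ → ℝ
  | 0 => 0
  | 1 => Real.sqrt d * 2 ^ (-(n : ℤ))
  | k + 2 =>
      if k + 2 ≤ M then
        gridTimes d n T τ M (k + 1) +
          (1 - Real.sqrt d * 2 ^ (-(n : ℤ)) / T) *
            sSup {s : ℝ | s ∈ Bset d (n + (k + 2)) ∧ s < τ (k + 1) - τ k}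
      else T

theorem sup_aux (d i : ℕ) (hd : 1 ≤ d) (g : ℝ) (hg : 0 < g) :
    0 < sSup {s : ℝ | s ∈ Bset d i ∧ s < g} ∧
    sSup {s : ℝ | s ∈ Bset d i ∧ s < g} ≤ g ∧
    g - Real.sqrt d * 2 ^ (-(i : ℤ)) ≤ sSup {s : ℝ | s ∈ Bset d i ∧ s < g} := by
  have hdp : (0:ℝ) < d := by exact_mod_cast hd
  have hh : 0 < Real.sqrt d * 2 ^ (-(i : ℤ)) := by positivity
  have hbdd : BddAbove {s : ℝ | s ∈ Bset d i ∧ s < g} := ⟨g, fun s hs => hs.2.le⟩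
  obtain ⟨k, hk⟩ := exists_nat_gt (Real.sqrt d * 2 ^ (-(i : ℤ)) / g)
  have hk0 : (0:ℝ) < k := lt_trans (by positivity) hk
  have hmem : Real.sqrt d * 2 ^ (-(i : ℤ)) / (k:ℝ) ∈ {s : ℝ | s ∈ Bset d i ∧ s < g} := by
    refine ⟨Or.inr ⟨k, by exact_mod_cast hk0, rfl⟩, ?_⟩
    rw [div_lt_iff₀ hg] at hk
    rw [div_lt_iff₀ hk0]
    linarith
  have hpos : 0 < sSup {s : ℝ | s ∈ Bset d i ∧ s < g} :=
    lt_of_lt_of_le (by positivity) (le_csSup hbdd hmem)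
  refine ⟨hpos, csSup_le ⟨_, hmem⟩ (fun s hs => hs.2.le), ?_⟩
  rcases le_or_gt g (Real.sqrt d * 2 ^ (-(i : ℤ))) with h | h
  · linarith
  · generalize hH : Real.sqrt d * 2 ^ (-(i : ℤ)) = H at *
    obtain ⟨m, hm⟩ : ∃ m, m + 1 = ⌈g / H⌉₊ :=
      ⟨⌈g / H⌉₊ - 1, Nat.succ_pred_eq_of_pos (Nat.ceil_pos.2 (by positivity))⟩
    have h1 : g / H ≤ (m:ℝ) + 1 := by
      have := Nat.le_ceil (g / H)
      rw [← hm] at this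
      exact_mod_cast this
    have h2 : (m:ℝ) < g / H := Nat.lt_ceil.1 (by omega)
    rw [div_le_iff₀ hh] at h1
    rw [lt_div_iff₀ hh] at h2
    have hm0 : 0 < m := by
      rcases Nat.eq_zero_or_pos m with h0 | h0
      · subst h0
        norm_num at h1
        linarith
      · exact h0
    have := le_csSup hbdd (a := (m:ℝ) * H) ⟨Or.inl ⟨m, hm0, by rw [hH]⟩, h2⟩
    linarith

/-- given `0 = τ_0 < τ_1 < ⋯ < τ_M = T` with increments at most
`√d·2^{-n} < T`, the grid times satisfy
`0 = τ̂_0 < √d·2^{-n} = τ̂_1 < ⋯ < τ̂_M < τ̂_{M+1} = T` and `|τ̂_k − τ_k| ≤ √d·2^{-n+1}`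
for `k = 0,…,M`. -/
theorem statement1 (d n M : ℕ) (hd : 1 ≤ d) (hM : 1 ≤ M) (T : ℝ) (hT : 0 < T)
    (hδT : Real.sqrt d * 2 ^ (-(n : ℤ)) < T)
    (τ : ℕ → ℝ) (hτ0 : τ 0 = 0) (hτM : τ M = T)
    (hmono : ∀ k < M, τ k < τ (k + 1))
    (hstep : ∀ k < M, τ (k + 1) - τ k ≤ Real.sqrt d * 2 ^ (-(n : ℤ))) :
    (gridTimes d n T τ M 0 = 0 ∧
      gridTimes d n T τ M 1 = Real.sqrt d * 2 ^ (-(n : ℤ)) ∧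
      gridTimes d n T τ M (M + 1) = T ∧
      ∀ k ≤ M, gridTimes d n T τ M k < gridTimes d n T τ M (k + 1)) ∧
    ∀ k ≤ M, |gridTimes d n T τ M k - τ k| ≤ Real.sqrt d * 2 ^ (-(n : ℤ) + 1) := by
  have hdp : (0:ℝ) < d := by exact_mod_cast hd
  have hδ : 0 < Real.sqrt d * 2 ^ (-(n : ℤ)) := by positivity
  have h0 : gridTimes d n T τ M 0 = 0 := by rw [gridTimes]
  have h1 : gridTimes d n T τ M 1 = Real.sqrt d * 2 ^ (-(n : ℤ)) := by rw [gridTimes]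
  have hrec : ∀ k, k + 2 ≤ M → ∃ S : ℝ, gridTimes d n T τ M (k + 2) =
      gridTimes d n T τ M (k + 1) + (1 - Real.sqrt d * 2 ^ (-(n : ℤ)) / T) * S ∧ 0 < S ∧
      S ≤ τ (k + 1) - τ k ∧
      τ (k + 1) - τ k - Real.sqrt d * 2 ^ (-(n : ℤ)) * (1 / 2) ^ (k + 2) ≤ S := by
    intro k hk
    obtain ⟨a, b, c⟩ := sup_aux d (n + (k + 2)) hd (τ (k + 1) - τ k)
      (by have := hmono k (by omega); linarith)
    refine ⟨_, by rw [gridTimes, if_pos hk], a, b, ?_⟩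
    have e : Real.sqrt d * 2 ^ (-((n + (k + 2) : ℕ) : ℤ)) =
        Real.sqrt d * 2 ^ (-(n : ℤ)) * (1 / 2) ^ (k + 2) := by
      rw [zpow_neg, zpow_neg, zpow_natCast, zpow_natCast, pow_add]
      rw [one_div, inv_pow, mul_inv]
      ring
    rw [e] at c
    exact c
  have hlast : gridTimes d n T τ M (M + 1) = T := by
    obtain ⟨m, rfl⟩ : ∃ m, M = m + 1 := ⟨M - 1, by omega⟩
    rw [gridTimes, if_neg (by omega)]
  have e2 : Real.sqrt d * 2 ^ (-(n : ℤ) + 1) = 2 * (Real.sqrt d * 2 ^ (-(n : ℤ))) := by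
    rw [zpow_add₀ (by norm_num), zpow_one]; ring
  rw [e2]
  generalize Real.sqrt d * 2 ^ (-(n : ℤ)) = δ at *
  generalize gridTimes d n T τ M = G at *
  obtain ⟨c, hc⟩ : ∃ c, c = 1 - δ / T := ⟨_, rfl⟩
  rw [← hc] at hrec
  have hcT : c * T = T - δ := by rw [hc]; field_simp
  have hc0 : 0 < c := by
    rw [hc, sub_pos, div_lt_one hT]; exact hδT
  have hc1 : c < 1 := by
    have : 0 < δ / T := by positivity
    linarith
  have hnn : ∀ k ≤ M, 0 ≤ τ k := by
    intro k
    induction k with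
    | zero => intro _; exact hτ0.ge
    | succ k ih => intro hk; have := ih (by omega); have := hmono k (by omega); linarith
  have hle : ∀ j, ∀ k, k + j = M → τ k ≤ T := by
    intro j
    induction j with
    | zero => intro k hk; rw [← hτM, ← hk]; rfl
    | succ j ih =>
      intro k hk; have := ih (k + 1) (by omega); have := hmono k (by omega); linarith
  have hup : ∀ k, k + 1 ≤ M → G (k + 1) ≤ δ + c * τ k ∧
      δ + c * (τ k - δ * (1 / 2) * (1 - (1 / 2) ^ k)) ≤ G (k + 1) := by
    intro k
    induction k with
    | zero => intro _; rw [zero_add, h1, hτ0]; simp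
    | succ k ih =>
      intro hk
      obtain ⟨u, l⟩ := ih (by omega)
      obtain ⟨S, hS, _, b, a⟩ := hrec k hk
      have b' := mul_le_mul_of_nonneg_left b hc0.le
      have a' := mul_le_mul_of_nonneg_left a hc0.le
      rw [show k + 1 + 1 = k + 2 from rfl, hS]
      constructor
      · linarith
      · rw [pow_succ] at a' ⊢
        rw [pow_succ] at a'
        linarith
  refine ⟨⟨h0, h1, hlast, ?_⟩, ?_⟩
  · intro k hk
    rcases hk.eq_or_lt with rfl | hk
    · obtain ⟨m, rfl⟩ : ∃ m, k = m + 1 := ⟨k - 1, by omega⟩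
      rw [hlast]
      have := (hup m le_rfl).1
      have h3 := hmono m (by omega)
      rw [hτM] at h3
      have := mul_lt_mul_of_pos_left h3 hc0
      linarith
    · rcases k with _ | k
      · rw [zero_add, h0, h1]; exact hδ
      · obtain ⟨S, hS, p, _⟩ := hrec k hk
        rw [show k + 1 + 1 = k + 2 from rfl, hS]
        have := mul_pos hc0 p
        linarith
  · intro k hk
    rcases k with _ | k
    · rw [h0, hτ0]; simp; exact hδ.le
    · obtain ⟨u, l⟩ := hup k hk
      have n0 := hnn k (by omega)
      have t1 := hle (M - k) k (by omega)
      have m1 := hmono k (by omega)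
      have s1 := hstep k (by omega)
      have p1 : 0 ≤ ((1:ℝ) / 2) ^ k := by positivity
      have q1 : c * τ k ≤ τ k := by nlinarith
      have q2 : τ k - δ ≤ c * τ k := by nlinarith
      have q3 : c * (δ * (1 / 2) * (1 - (1 / 2) ^ k)) ≤ δ := by
        have : 0 ≤ c * δ * (1 / 2) ^ k := by positivity
        nlinarith
      rw [abs_le]
      constructor <;> linarith

end
end
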